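/- arXiv:1310.7066 — 13 statements merged into one kernel-verified Lean document; each statement's English description precedes it below -/
import Mathlib

section
/- Let n be a natural number and let G be a subgroup of the symmetric group Equiv.Perm (Fin n). Then the sum, over all G-orbits Ω of subsets of Fin n, of (−1)^{w(Ω)} (where w(Ω) is the cardinality of any representative of Ω) equals the number of self-complementary G-orbits, i.e. the number of orbits Ω satisfying {univ \ S : S ∈ Ω} = Ω. -/
open MulAction Pointwise
open scoped Classical

section SignedCount

variable {α : Type*}

lemma neg_one_pow_card_symmDiff [Fintype α] [DecidableEq α] (S T : Finset α) :
    (-1 : ℤ) ^ (symmDiff S T).card = (-1) ^ S.card * (-1) ^ T.card := by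
  have h (U : Finset α) : (-1 : ℤ) ^ U.card = ∏ x : α, if x ∈ U then -1 else 1 := by
    simp
  rw [h, h, h, ← Finset.prod_mul_distrib]
  refine Finset.prod_congr rfl fun x _ => ?_
  by_cases hS : x ∈ S <;> by_cases hT : x ∈ T <;> simp [Finset.mem_symmDiff, hS, hT]

lemma even_card_of_invariant_of_swapped [DecidableEq α] (g : Equiv.Perm α) {S T : Finset α}
    (hS : ∀ x, g x ∈ S ↔ x ∈ S) (hT : ∀ x, g x ∈ T ↔ x ∉ T) : Even S.card := by
  have h : (S.filter (· ∈ T)).card = (S.filter (· ∉ T)).card := by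
    refine Finset.card_bij (fun x _ => g x) ?_ (fun _ _ _ _ h => g.injective h) ?_
    · intro x hx
      simp_all
    · intro y hy
      obtain ⟨x, rfl⟩ := g.surjective y
      exact ⟨x, by simp_all, rfl⟩
  rw [← Finset.card_filter_add_card_filter_not (s := S) (· ∈ T), h]
  exact ⟨_, rfl⟩

lemma zpow_apply_ne_of_odd [Fintype α] (g : Equiv.Perm α)
    (h : ∀ S : Finset α, (∀ x, g x ∈ S ↔ x ∈ S) → Even S.card) (r : α) {m : ℤ} (hm : Odd m) :
    (g ^ m) r ≠ r := by
  intro hr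
  let S : Finset α := Finset.univ.filter (· ∈ orbit (Subgroup.zpowers g) r)
  have hS : ∀ x, g x ∈ S ↔ x ∈ S := by
    intro x
    have : g x = (⟨g, Subgroup.mem_zpowers g⟩ : Subgroup.zpowers g) • x := rfl
    simp only [S, Finset.mem_filter, Finset.mem_univ, true_and]
    rw [this, ← orbit_eq_iff, orbit_smul, orbit_eq_iff]
  have hcard : S.card = Function.minimalPeriod (g • ·) r := by
    rw [minimalPeriod_eq_card, Fintype.card_subtype]
  have hdvd : (Function.minimalPeriod (g • ·) r : ℤ) ∣ m :=
    zpow_smul_eq_iff_minimalPeriod_dvd.mp hr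
  have h2 : (2 : ℤ) ∣ S.card := by exact_mod_cast (h S hS).two_dvd
  rw [hcard] at h2
  exact (Int.not_even_iff_odd.mpr hm) (even_iff_two_dvd.mpr (h2.trans hdvd))

lemma exists_swapped_of_forall_even [Fintype α] [DecidableEq α] (g : Equiv.Perm α)
    (h : ∀ S : Finset α, (∀ x, g x ∈ S ↔ x ∈ S) → Even S.card) :
    ∃ T : Finset α, ∀ x, g x ∈ T ↔ x ∉ T := by
  let s : Setoid α := Equiv.Perm.SameCycle.setoid g
  let r : α → α := fun x => (Quotient.mk s x).out
  have hr (x : α) : ∃ k : ℤ, (g ^ k) (r x) = x := Quotient.mk_out (s := s) x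
  have hrg (x : α) : r (g x) = r x := by
    have : Quotient.mk s (g x) = Quotient.mk s x :=
      Quotient.sound (s := s) (Equiv.Perm.sameCycle_apply_left.mpr (Equiv.Perm.SameCycle.refl g x))
    simp only [r, this]
  refine ⟨Finset.univ.filter fun x => ∃ k : ℤ, Even k ∧ (g ^ k) (r x) = x, fun x => ?_⟩
  simp only [Finset.mem_filter, Finset.mem_univ, true_and, hrg]
  constructor
  · rintro ⟨k, hk, hkx⟩ ⟨l, hl, hlx⟩
    refine zpow_apply_ne_of_odd g h (r x) (m := -k + (1 + l)) (by grind) ?_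
    rw [zpow_add, zpow_add, Equiv.Perm.mul_apply, Equiv.Perm.mul_apply, hlx, zpow_one, zpow_neg,
      Equiv.Perm.inv_eq_iff_eq, hkx]
  · intro hx
    obtain ⟨k, hk⟩ := hr x
    have hodd : Odd k := Int.not_even_iff_odd.mp fun he => hx ⟨k, he, hk⟩
    refine ⟨1 + k, by grind, ?_⟩
    rw [zpow_add, Equiv.Perm.mul_apply, hk, zpow_one]

lemma sum_neg_one_pow_card_invariant [Fintype α] [DecidableEq α] (g : Equiv.Perm α) :
    ∑ S : Finset α with ∀ x, g x ∈ S ↔ x ∈ S, (-1 : ℤ) ^ S.card =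
      (Finset.univ.filter fun T : Finset α => ∀ x, g x ∈ T ↔ x ∉ T).card := by
  by_cases h : ∀ S : Finset α, (∀ x, g x ∈ S ↔ x ∈ S) → Even S.card
  · obtain ⟨T, hT⟩ := exists_swapped_of_forall_even g h
    rw [Finset.sum_congr rfl fun S hS => (h S (by simpa using hS)).neg_one_pow,
      Finset.sum_const, nsmul_one, Nat.cast_inj]
    refine Finset.card_bij' (fun S _ => symmDiff S T) (fun S _ => symmDiff S T) ?_ ?_ ?_ ?_
    · intro S hS
      simp only [Finset.mem_filter, Finset.mem_univ, true_and, Finset.mem_symmDiff] at hS ⊢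
      intro x
      have := hS x
      have := hT x
      tauto
    · intro S hS
      simp only [Finset.mem_filter, Finset.mem_univ, true_and, Finset.mem_symmDiff] at hS ⊢
      intro x
      have := hS x
      have := hT x
      tauto
    · intro S _
      exact symmDiff_symmDiff_cancel_right T S
    · intro S _
      exact symmDiff_symmDiff_cancel_right T S
  · push Not at h
    obtain ⟨A, hA, hodd⟩ := h
    rw [Nat.not_even_iff_odd] at hodd
    have hempty : (Finset.univ.filter fun T : Finset α => ∀ x, g x ∈ T ↔ x ∉ T) = ∅ :=
      Finset.filter_eq_empty_iff.mpr fun T _ hT =>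
        Nat.not_even_iff_odd.mpr hodd (even_card_of_invariant_of_swapped g hA hT)
    rw [hempty, Finset.card_empty, Nat.cast_zero]
    have hsign (S : Finset α) : (-1 : ℤ) ^ (symmDiff S A).card = -(-1) ^ S.card := by
      rw [neg_one_pow_card_symmDiff, hodd.neg_one_pow, mul_neg_one]
    refine Finset.sum_involution (fun S _ => symmDiff S A) ?_ ?_ ?_ ?_
    · intro S _
      rw [hsign, add_neg_cancel]
    · intro S _ hne heq
      have := hsign S
      rw [heq] at this
      omega
    · intro S hS
      simp only [Finset.mem_filter, Finset.mem_univ, true_and, Finset.mem_symmDiff] at hS ⊢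
      intro x
      rw [hS x, hA x]
    · intro S _
      exact symmDiff_symmDiff_cancel_right A S

lemma smul_finset_eq_self_iff [DecidableEq α] (g : Equiv.Perm α) (S : Finset α) :
    g • S = S ↔ ∀ x, g x ∈ S ↔ x ∈ S := by
  have key (x : α) : g x ∈ g • S ↔ x ∈ S := Finset.smul_mem_smul_finset_iff g
  constructor
  · intro h x
    rw [← key x, h]
  · intro h
    ext y
    obtain ⟨x, rfl⟩ := g.surjective y
    rw [key, h]

lemma smul_finset_eq_compl_iff [Fintype α] [DecidableEq α] (g : Equiv.Perm α) (S : Finset α) :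
    g • S = Sᶜ ↔ ∀ x, g x ∈ S ↔ x ∉ S := by
  have key (x : α) : g x ∈ g • S ↔ x ∈ S := Finset.smul_mem_smul_finset_iff g
  constructor
  · intro h x
    rw [← key x, h, Finset.mem_compl, not_not]
  · intro h
    ext y
    obtain ⟨x, rfl⟩ := g.surjective y
    rw [key, Finset.mem_compl, h, not_not]

end SignedCount

section Burnside

variable {G X : Type*} [Group G] [MulAction G X] [Fintype G] [DecidableEq X]

lemma sum_card_stabilizer_mul [Fintype X] (F : X → ℤ) (hF : ∀ (g : G) x, F (g • x) = F x) :
    ∑ x : X, ((Finset.univ.filter fun g : G => g • x = x).card : ℤ) * F x =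
      Fintype.card G * ∑ Ω : orbitRel.Quotient G X, F (Quotient.out Ω) := by
  rw [← Finset.sum_fiberwise Finset.univ (fun x => (Quotient.mk (orbitRel G X) x)),
    Finset.mul_sum]
  refine Finset.sum_congr rfl fun Ω _ => ?_
  have hfib : (Finset.univ.filter fun x => Quotient.mk (orbitRel G X) x = Ω) =
      (orbit G Ω.out).toFinset := by
    ext x
    simp only [Finset.mem_filter, Finset.mem_univ, true_and, Set.mem_toFinset]
    exact Quotient.mk_eq_iff_out
  have hstab (x : X) (hx : x ∈ orbit G Ω.out) :
      (Finset.univ.filter fun g : G => g • x = x).card * (orbit G Ω.out).toFinset.card =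
        Fintype.card G := by
    rw [← orbit_eq_iff.mpr hx, ← card_orbit_mul_card_stabilizer_eq_card_group G x, mul_comm,
      Set.toFinset_card, ← Fintype.card_subtype]
    rfl
  rw [hfib]
  have hconst : ∀ x ∈ (orbit G Ω.out).toFinset,
      ((Finset.univ.filter fun g : G => g • x = x).card : ℤ) * F x =
      ((Finset.univ.filter fun g : G => g • Ω.out = Ω.out).card : ℤ) * F Ω.out := by
    intro x hx
    rw [Set.mem_toFinset] at hx
    have hpos : (orbit G Ω.out).toFinset.card ≠ 0 :=
      Finset.card_ne_zero_of_mem (Set.mem_toFinset.mpr hx)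
    rw [Nat.mul_right_cancel (Nat.pos_of_ne_zero hpos)
      ((hstab x hx).trans (hstab _ (mem_orbit_self _)).symm)]
    obtain ⟨g, rfl⟩ := hx
    exact congrArg _ (hF g _)
  rw [Finset.sum_congr rfl hconst, Finset.sum_const, nsmul_eq_mul,
    ← hstab _ (mem_orbit_self _), Nat.cast_mul]
  ring

lemma card_smul_eq (x y : X) :
    (Finset.univ.filter fun g : G => g • x = y).card =
      (Finset.univ.filter fun g : G => g • x = x).card * if y ∈ orbit G x then 1 else 0 := by
  split_ifs with h
  · obtain ⟨k, rfl⟩ := h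
    rw [mul_one]
    refine Finset.card_bij' (fun g _ => k⁻¹ * g) (fun g _ => k * g) ?_ ?_ ?_ ?_ <;>
      simp +contextual [mul_smul]
  · rw [mul_zero, Finset.card_eq_zero, Finset.filter_eq_empty_iff]
    exact fun g _ hg => h ⟨g, hg⟩

end Burnside

/-- **de Bruijn's theorem** (Theorem 2.2): the generating function `X(G,q)` counting `G`-orbits
of subsets of `[n]` by the cardinality of a representative, evaluated at `q = -1`, equals the
number of self-complementary `G`-orbits. -/
theorem de_bruijn_q_eq_neg_one (n : ℕ) (G : Subgroup (Equiv.Perm (Fin n))) :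
    (∑ Ω : orbitRel.Quotient G (Finset (Fin n)), (-1 : ℤ) ^ (Quotient.out Ω).card) =
      ((Finset.univ.filter fun Ω : orbitRel.Quotient G (Finset (Fin n)) =>
        (fun S => (Finset.univ : Finset (Fin n)) \ S) '' orbit G (Quotient.out Ω) =
          orbit G (Quotient.out Ω)).card : ℤ) := by
  have hcompl (g : G) (S : Finset (Fin n)) : (g • S)ᶜ = g • Sᶜ := by
    ext y
    obtain ⟨x, rfl⟩ := MulAction.surjective g y
    simp only [Finset.mem_compl, Finset.smul_mem_smul_finset_iff]
  have hself (S : Finset (Fin n)) :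
      (fun S => (Finset.univ : Finset (Fin n)) \ S) '' orbit G S = orbit G S ↔
        Sᶜ ∈ orbit G S := by
    have himage : (fun S => (Finset.univ : Finset (Fin n)) \ S) '' orbit G S = orbit G Sᶜ := by
      ext T
      simp only [← Finset.compl_eq_univ_sdiff, Set.mem_image, mem_orbit_iff,
        exists_exists_eq_and, hcompl]
    rw [himage, orbit_eq_iff]
  have hinv (g : G) (S : Finset (Fin n)) :
      (if (g • S)ᶜ ∈ orbit G (g • S) then (1 : ℤ) else 0) =
        if Sᶜ ∈ orbit G S then 1 else 0 := by
    rw [hcompl, orbit_smul, ← orbit_eq_iff, orbit_smul, orbit_eq_iff]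
  simp only [hself]
  rw [Finset.card_filter]
  push_cast
  have hG : (Fintype.card G : ℤ) ≠ 0 := Nat.cast_ne_zero.mpr Fintype.card_ne_zero
  apply mul_left_cancel₀ hG
  rw [← sum_card_stabilizer_mul (G := G) (fun S : Finset (Fin n) => (-1 : ℤ) ^ S.card)
      fun g S => by rw [Finset.card_smul_finset],
    ← sum_card_stabilizer_mul (G := G)
      (fun S : Finset (Fin n) => if Sᶜ ∈ orbit G S then (1 : ℤ) else 0) hinv]
  have hright (S : Finset (Fin n)) :
      ((Finset.univ.filter fun g : G => g • S = S).card : ℤ) *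
        (if Sᶜ ∈ orbit G S then 1 else 0) = ∑ g : G, if g • S = Sᶜ then 1 else 0 := by
    rw [← Finset.natCast_card_filter, card_smul_eq S Sᶜ]
    push_cast
    rfl
  have hleft (S : Finset (Fin n)) :
      ((Finset.univ.filter fun g : G => g • S = S).card : ℤ) * (-1) ^ S.card =
        ∑ g : G, if g • S = S then (-1) ^ S.card else 0 := by
    rw [← Finset.sum_filter, Finset.sum_const, nsmul_eq_mul]
  simp only [hleft, hright]
  rw [Finset.sum_comm]
  conv_rhs => rw [Finset.sum_comm]
  refine Finset.sum_congr rfl fun g _ => ?_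
  have h := sum_neg_one_pow_card_invariant (g : Equiv.Perm (Fin n))
  simp only [← smul_finset_eq_self_iff, ← smul_finset_eq_compl_iff] at h
  rw [← Finset.sum_filter, ← Finset.natCast_card_filter]
  exact h
end

section
/- Let n be a natural number, G a subgroup of Equiv.Perm (Fin n), and for 0 ≤ i ≤ n let a_i be the number of G-orbits on the i-element subsets of Fin n. Then the sequence (a_0, a_1, …, a_n) is symmetric and unimodal: a_i = a_{n−i} for all 0 ≤ i ≤ n, and a_{i−1} ≤ a_i whenever 1 ≤ i and 2i ≤ n. -/
open MulAction Pointwise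
open scoped Classical

/-- The raising operator on functions on the Boolean lattice: sum over the sets covered by `T`. -/
def raising {α : Type*} [DecidableEq α] (f : Finset α → ℚ) (T : Finset α) : ℚ :=
  ∑ x ∈ T, f (T.erase x)

/-- The lowering operator on functions on the Boolean lattice: sum over the sets covering `S`. -/
def lowering {α : Type*} [DecidableEq α] [Fintype α] (f : Finset α → ℚ) (S : Finset α) : ℚ :=
  ∑ x ∈ Sᶜ, f (insert x S)

lemma sum_mul_raising {α : Type*} [DecidableEq α] [Fintype α] (f g : Finset α → ℚ) :
    ∑ T, g T * raising f T = ∑ S, lowering g S * f S := by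
  simp only [raising, lowering, Finset.mul_sum, Finset.sum_mul]
  rw [Finset.sum_sigma', Finset.sum_sigma']
  refine Finset.sum_nbij' (fun p => ⟨p.1.erase p.2, p.2⟩) (fun p => ⟨insert p.2 p.1, p.2⟩)
    ?_ ?_ ?_ ?_ ?_
  · rintro ⟨T, x⟩ h
    simp
  · rintro ⟨S, x⟩ h
    simp
  · rintro ⟨T, x⟩ h
    have hx : x ∈ T := by simpa using h
    simp [Finset.insert_erase hx]
  · rintro ⟨S, x⟩ h
    have hx : x ∉ S := by simpa using h
    simp [Finset.erase_insert hx]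
  · rintro ⟨T, x⟩ h
    have hx : x ∈ T := by simpa using h
    simp [Finset.insert_erase hx]

lemma lowering_raising {α : Type*} [DecidableEq α] [Fintype α] (f : Finset α → ℚ)
    (S : Finset α) :
    lowering (raising f) S =
      raising (lowering f) S + ((Fintype.card α : ℚ) - 2 * S.card) * f S := by
  have h1 : lowering (raising f) S =
      (Sᶜ.card : ℚ) * f S + ∑ x ∈ Sᶜ, ∑ y ∈ S, f ((insert x S).erase y) := by
    rw [← nsmul_eq_mul, ← Finset.sum_const, ← Finset.sum_add_distrib]
    refine Finset.sum_congr rfl fun x hx => ?_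
    have hx : x ∉ S := by simpa using hx
    rw [raising, Finset.sum_insert hx, Finset.erase_insert hx]
  have h2 : raising (lowering f) S =
      (S.card : ℚ) * f S + ∑ y ∈ S, ∑ x ∈ Sᶜ, f ((insert x S).erase y) := by
    rw [← nsmul_eq_mul, ← Finset.sum_const, ← Finset.sum_add_distrib]
    refine Finset.sum_congr rfl fun y hy => ?_
    rw [lowering, Finset.compl_erase, Finset.sum_insert (by simpa using hy),
      Finset.insert_erase hy]
    congr 1
    refine Finset.sum_congr rfl fun x hx => ?_
    have hxy : x ≠ y := by
      rintro rfl
      simp [hy] at hx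
    rw [Finset.erase_insert_of_ne hxy]
  have h3 : (S.card : ℚ) + Sᶜ.card = Fintype.card α := by
    exact_mod_cast S.card_add_card_compl
  rw [h1, h2, Finset.sum_comm, ← h3]
  ring

/-- The raising operator is injective on functions supported strictly below the middle level. -/
lemma eq_zero_of_raising_eq_zero {α : Type*} [DecidableEq α] [Fintype α] (f : Finset α → ℚ)
    (hf : ∀ S, f S ≠ 0 → 2 * S.card < Fintype.card α) (h : ∀ T, raising f T = 0) (S : Finset α) :
    f S = 0 := by
  have key : ∑ S, lowering f S * lowering f S +
      ∑ S : Finset α, ((Fintype.card α : ℚ) - 2 * S.card) * (f S * f S) = 0 := by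
    have h1 := sum_mul_raising f (raising f)
    have h2 := sum_mul_raising (lowering f) f
    simp only [h, mul_zero, Finset.sum_const_zero, lowering_raising, add_mul,
      Finset.sum_add_distrib] at h1
    rw [← h2, h1]
    congr 1
    · exact Finset.sum_congr rfl fun S _ => mul_comm _ _
    · exact Finset.sum_congr rfl fun S _ => by ring
  have hnonneg : ∀ S ∈ (Finset.univ : Finset (Finset α)),
      0 ≤ ((Fintype.card α : ℚ) - 2 * S.card) * (f S * f S) := by
    intro S _
    by_cases h0 : f S = 0
    · simp [h0]
    · have : (2 * S.card : ℚ) < Fintype.card α := by exact_mod_cast hf S h0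
      exact mul_nonneg (by linarith) (mul_self_nonneg _)
  have hle : 0 ≤ ∑ S, lowering f S * lowering f S :=
    Finset.sum_nonneg fun S _ => mul_self_nonneg _
  have hz := (Finset.sum_eq_zero_iff_of_nonneg hnonneg).1
    (le_antisymm (by linarith) (Finset.sum_nonneg hnonneg)) S (Finset.mem_univ S)
  by_contra h0
  have : (2 * S.card : ℚ) < Fintype.card α := by exact_mod_cast hf S h0
  have : (Fintype.card α : ℚ) - 2 * S.card ≠ 0 := by linarith
  simp_all

lemma raising_smul {α M : Type*} [DecidableEq α] [Group M] [MulAction M α]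
    (f : Finset α → ℚ) (hf : ∀ (g : M) S, f (g • S) = f S) (g : M) (T : Finset α) :
    raising f (g • T) = raising f T := by
  have h : ∀ x, (g • T).erase (g • x) = g • T.erase x := fun x => by
    simp [Finset.erase_eq, Finset.smul_finset_sdiff]
  unfold raising
  rw [Finset.smul_finset_def, Finset.sum_image (MulAction.injective g).injOn]
  exact Finset.sum_congr rfl fun x _ => by rw [← Finset.smul_finset_def, h, hf]

/-- The orbits of a group on the `i`-element subsets are at most as many as those on the
`i + 1`-element subsets if `2 * i` is less than the number of points. -/
lemma card_orbits_le_succ {α M : Type*} [DecidableEq α] [Fintype α] [Group M] [MulAction M α]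
    (i : ℕ) (hi : 2 * i < Fintype.card α) :
    ((Finset.univ.filter fun S : Finset α => S.card = i).image fun S => orbit M S).card ≤
      ((Finset.univ.filter fun S : Finset α => S.card = i + 1).image
        fun S => orbit M S).card := by
  set A := (Finset.univ.filter fun S : Finset α => S.card = i).image fun S => orbit M S with hA
  set B := (Finset.univ.filter fun S : Finset α => S.card = i + 1).image
    fun S => orbit M S with hB
  have hmem : ∀ S : Finset α, S.card = i → orbit M S ∈ A := fun S hS =>
    Finset.mem_image_of_mem _ (by simpa using hS)
  have hrep : ∀ o : B, ∃ T : Finset α, T.card = i + 1 ∧ orbit M T = o := by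
    rintro ⟨o, ho⟩
    simpa [hB] using ho
  choose rep _ hrep_orbit using hrep
  let lift : (A → ℚ) → Finset α → ℚ := fun h S =>
    if hS : S.card = i then h ⟨orbit M S, hmem S hS⟩ else 0
  have lift_smul : ∀ h (g : M) S, lift h (g • S) = lift h S := fun h g S => by
    simp [lift, Finset.card_smul_finset, MulAction.orbit_smul]
  let Φ : (A → ℚ) →ₗ[ℚ] (B → ℚ) :=
    { toFun := fun h o => raising (lift h) (rep o)
      map_add' := fun h k => by
        ext o
        simp only [raising, Pi.add_apply, ← Finset.sum_add_distrib]
        refine Finset.sum_congr rfl fun x _ => ?_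
        simp only [lift]
        split_ifs <;> simp
      map_smul' := fun c h => by
        ext o
        simp only [raising, Pi.smul_apply, smul_eq_mul, Finset.mul_sum, RingHom.id_apply]
        refine Finset.sum_congr rfl fun x _ => ?_
        simp only [lift]
        split_ifs <;> simp }
  have hΦ : Function.Injective Φ := by
    rw [injective_iff_map_eq_zero]
    intro h hh
    have hzero : ∀ T, raising (lift h) T = 0 := by
      intro T
      by_cases hT : T.card = i + 1
      · have hTB : orbit M T ∈ B := Finset.mem_image_of_mem _ (by simpa using hT)
        obtain ⟨g, hg⟩ : rep ⟨orbit M T, hTB⟩ ∈ orbit M T :=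
          MulAction.orbit_eq_iff.1 (hrep_orbit ⟨orbit M T, hTB⟩)
        have h0 : raising (lift h) (rep ⟨orbit M T, hTB⟩) = 0 := congrFun hh _
        rw [← hg] at h0
        rwa [← raising_smul (lift h) (lift_smul h) g T]
      · refine Finset.sum_eq_zero fun x hx => dif_neg ?_
        have := Finset.card_erase_add_one hx
        omega
    have hlift := eq_zero_of_raising_eq_zero (lift h) (fun S hS => by
      by_cases hc : S.card = i
      · rwa [hc]
      · exact absurd (dif_neg hc) hS) hzero
    ext ⟨o, ho⟩
    obtain ⟨S, hS, rfl⟩ : ∃ S : Finset α, S.card = i ∧ orbit M S = o := by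
      simpa [hA] using ho
    simpa [lift, hS] using hlift S
  simpa using LinearMap.finrank_le_finrank_of_injective hΦ

lemma orbit_finset_compl {α M : Type*} [DecidableEq α] [Fintype α] [Group M] [MulAction M α]
    (S : Finset α) : orbit M Sᶜ = compl '' orbit M S := by
  have h : ∀ g : M, g • Sᶜ = (g • S)ᶜ := fun g => by
    simp [Finset.compl_eq_univ_sdiff, Finset.smul_finset_sdiff]
  ext T
  simp [MulAction.mem_orbit_iff, h]

lemma card_orbits_compl {α M : Type*} [DecidableEq α] [Fintype α] [Group M] [MulAction M α]
    (i : ℕ) (hi : i ≤ Fintype.card α) :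
    ((Finset.univ.filter fun S : Finset α => S.card = i).image fun S => orbit M S).card =
      ((Finset.univ.filter fun S : Finset α => S.card = Fintype.card α - i).image
        fun S => orbit M S).card := by
  rw [← Finset.card_image_of_injective _ (compl_injective (α := Finset α)).image_injective,
    Finset.image_image]
  congr 1
  ext o
  simp only [Finset.mem_image, Finset.mem_filter, Finset.mem_univ, true_and,
    Function.comp_apply, ← orbit_finset_compl]
  constructor
  · rintro ⟨S, rfl, rfl⟩
    exact ⟨Sᶜ, Finset.card_compl S, rfl⟩
  · rintro ⟨S, hS, rfl⟩
    exact ⟨Sᶜ, by rw [Finset.card_compl]; omega, by rw [compl_compl]⟩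


/-- (Theorem 2.3, Stanley/Proctor.) The sequence `a_i` of numbers of `G`-orbits on `i`-element
subsets of `Fin n` is symmetric and unimodal. -/
theorem orbit_count_symmetric_unimodal (n : ℕ) (G : Subgroup (Equiv.Perm (Fin n))) :
    (∀ i ≤ n,
        (((Finset.univ.filter fun S : Finset (Fin n) => S.card = i).image
            fun S => orbit G S).card) =
        (((Finset.univ.filter fun S : Finset (Fin n) => S.card = n - i).image
            fun S => orbit G S).card)) ∧
    (∀ i : ℕ, 1 ≤ i → 2 * i ≤ n →
        (((Finset.univ.filter fun S : Finset (Fin n) => S.card = i - 1).image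
            fun S => orbit G S).card) ≤
        (((Finset.univ.filter fun S : Finset (Fin n) => S.card = i).image
            fun S => orbit G S).card)) := by
  refine ⟨fun i hi => ?_, fun i h1 h2 => ?_⟩
  · simpa using card_orbits_compl (α := Fin n) (M := G) i (by simpa using hi)
  · obtain ⟨k, rfl⟩ := Nat.exists_eq_add_of_le' h1
    simpa using card_orbits_le_succ (α := Fin n) (M := G) k (by rw [Fintype.card_fin]; omega)
end

section
/- Let n be a natural number, let Cℤ be the free ℤ-module with basis {e_T : T ∈ Finset (Fin n)}, let D(e_T) = ∑_{j ∈ T} e_{T.erase j}, and for a fixed subset S ⊆ Fin n let U^{(S)}(e_T) = ∑_{i ∈ S \ T} e_{insert i T}. Then for every T ∈ Finset (Fin n), (D ∘ U^{(S)} − U^{(S)} ∘ D)(e_T) = (|S| − 2·|S ∩ T|)·e_T. -/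
/-- The down map `D` on the free `ℤ`-module with basis the subsets of `Fin n`,
`D(e_T) = ∑_{j ∈ T} e_{T \ {j}}`. -/
noncomputable def downMapInt (n : ℕ) :
    (Finset (Fin n) →₀ ℤ) →ₗ[ℤ] (Finset (Fin n) →₀ ℤ) :=
  Finsupp.lift _ _ _ fun T => ∑ j ∈ T, Finsupp.single (T.erase j) (1 : ℤ)

/-- The `S`-masked up map `U^{(S)}(e_T) = ∑_{i ∈ S \ T} e_{T ∪ {i}}`. -/
noncomputable def maskedUpMap (n : ℕ) (S : Finset (Fin n)) :
    (Finset (Fin n) →₀ ℤ) →ₗ[ℤ] (Finset (Fin n) →₀ ℤ) :=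
  Finsupp.lift _ _ _ fun T => ∑ i ∈ S \ T, Finsupp.single (insert i T) (1 : ℤ)

theorem downMapInt_single (n : ℕ) (T : Finset (Fin n)) :
    downMapInt n (Finsupp.single T 1) = ∑ j ∈ T, Finsupp.single (T.erase j) (1 : ℤ) := by
  simp [downMapInt]

theorem maskedUpMap_single (n : ℕ) (S T : Finset (Fin n)) :
    maskedUpMap n S (Finsupp.single T 1) =
      ∑ i ∈ S \ T, Finsupp.single (insert i T) (1 : ℤ) := by
  simp [maskedUpMap]

theorem downMapInt_single_insert {n : ℕ} {T : Finset (Fin n)} {i : Fin n} (hi : i ∉ T) :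
    downMapInt n (Finsupp.single (insert i T) 1) =
      Finsupp.single T 1 + ∑ j ∈ T, Finsupp.single (insert i (T.erase j)) (1 : ℤ) := by
  rw [downMapInt_single, Finset.sum_insert hi, Finset.erase_insert hi]
  congr 1
  refine Finset.sum_congr rfl fun j hj => ?_
  rw [Finset.erase_insert_of_ne (ne_of_mem_of_not_mem hj hi).symm]

theorem maskedUpMap_single_erase {n : ℕ} (S : Finset (Fin n)) {T : Finset (Fin n)} {j : Fin n}
    (hj : j ∈ T) :
    maskedUpMap n S (Finsupp.single (T.erase j) 1) =
      (if j ∈ S then Finsupp.single T 1 else 0) +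
        ∑ i ∈ S \ T, Finsupp.single (insert i (T.erase j)) (1 : ℤ) := by
  rw [maskedUpMap_single]
  split_ifs with hS
  · rw [Finset.sdiff_erase hS, Finset.sum_insert (by simp [hj]), Finset.insert_erase hj]
  · rw [zero_add]
    refine Finset.sum_congr ?_ fun _ _ => rfl
    grind

/-- (Key computation in Theorem 2.7.)
`(D ∘ U^{(S)} − U^{(S)} ∘ D)(e_T) = (|S| − 2|S ∩ T|) e_T`. -/
theorem downMap_maskedUpMap_commutator (n : ℕ) (S T : Finset (Fin n)) :
    downMapInt n (maskedUpMap n S (Finsupp.single T 1)) -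
        maskedUpMap n S (downMapInt n (Finsupp.single T 1)) =
      ((S.card : ℤ) - 2 * ((S ∩ T).card : ℤ)) • Finsupp.single T (1 : ℤ) := by
  have hDU : downMapInt n (maskedUpMap n S (Finsupp.single T 1)) =
      ((S \ T).card : ℤ) • Finsupp.single T (1 : ℤ) +
        ∑ i ∈ S \ T, ∑ j ∈ T, Finsupp.single (insert i (T.erase j)) (1 : ℤ) := by
    rw [maskedUpMap_single, map_sum,
      Finset.sum_congr rfl fun i hi => downMapInt_single_insert (Finset.mem_sdiff.mp hi).2,
      Finset.sum_add_distrib, Finset.sum_const, natCast_zsmul]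
  have hUD : maskedUpMap n S (downMapInt n (Finsupp.single T 1)) =
      ((S ∩ T).card : ℤ) • Finsupp.single T (1 : ℤ) +
        ∑ i ∈ S \ T, ∑ j ∈ T, Finsupp.single (insert i (T.erase j)) (1 : ℤ) := by
    rw [downMapInt_single, map_sum,
      Finset.sum_congr rfl fun j hj => maskedUpMap_single_erase S hj,
      Finset.sum_add_distrib, Finset.sum_ite_mem, Finset.sum_const, Finset.inter_comm T S,
      natCast_zsmul, Finset.sum_comm]
  have hcard : (S.card : ℤ) = (S \ T).card + (S ∩ T).card := by
    exact_mod_cast (Finset.card_sdiff_add_card_inter S T).symm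
  rw [hDU, hUD, add_sub_add_right_eq_sub, ← sub_smul, hcard]
  congr 1
  ring
end

section
/- Let n be a natural number and G a subgroup of Equiv.Perm (Fin n). Suppose that some orbit of the action of G on Fin n has odd cardinality. Then for every i and every G-invariant element u of C that is homogeneous of degree i and satisfies D u = 0, there exists a G-invariant element v of C, homogeneous of degree i+1, with D v = u. (That is, the complex of G-invariants (C(𝔽₂)^G, D) is acyclic.) -/
/-- The down map `D` on the free `𝔽₂`-vector space with basis the subsets of `Fin n`. -/
noncomputable def downMap (n : ℕ) :
    (Finset (Fin n) →₀ ZMod 2) →ₗ[ZMod 2] (Finset (Fin n) →₀ ZMod 2) :=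
  Finsupp.lift _ _ _ fun S => ∑ j ∈ S, Finsupp.single (S.erase j) (1 : ZMod 2)

/-- `u` is `G`-invariant for the linear action `g · e_S = e_{g·S}`. -/
def IsGInvariant (n : ℕ) (G : Subgroup (Equiv.Perm (Fin n)))
    (u : Finset (Fin n) →₀ ZMod 2) : Prop :=
  ∀ g ∈ G, Finsupp.mapDomain (fun S : Finset (Fin n) => S.image ⇑g) u = u

/-- `u` is homogeneous of degree `i`: it lies in the span of the `e_S` with `|S| = i`. -/
def IsHomogeneousDeg (n : ℕ) (i : ℕ) (u : Finset (Fin n) →₀ ZMod 2) : Prop :=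
  u ∈ Submodule.span (ZMod 2)
    {f : Finset (Fin n) →₀ ZMod 2 |
      ∃ S : Finset (Fin n), S.card = i ∧ f = Finsupp.single S (1 : ZMod 2)}

/-- Multiplication by the variable `x_j` when `C` is identified with `𝔽₂[x_1, …, x_n] / (x_i ^ 2)`,
the basis element `e_S` being the monomial `∏ i ∈ S, x_i`. -/
noncomputable def mulVar (n : ℕ) (j : Fin n) :
    (Finset (Fin n) →₀ ZMod 2) →ₗ[ZMod 2] (Finset (Fin n) →₀ ZMod 2) :=
  Finsupp.lift _ _ _ fun S => if j ∈ S then 0 else Finsupp.single (insert j S) (1 : ZMod 2)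

theorem downMap_single (n : ℕ) (S : Finset (Fin n)) :
    downMap n (Finsupp.single S 1) = ∑ j ∈ S, Finsupp.single (S.erase j) (1 : ZMod 2) := by
  simp [downMap]

theorem mulVar_single (n : ℕ) (j : Fin n) (S : Finset (Fin n)) :
    mulVar n j (Finsupp.single S 1) =
      if j ∈ S then 0 else Finsupp.single (insert j S) (1 : ZMod 2) := by
  simp [mulVar]

/-- The Leibniz rule: `D` is a derivation with `D x_j = 1`. -/
theorem downMap_mulVar (n : ℕ) (j : Fin n) (u : Finset (Fin n) →₀ ZMod 2) :
    downMap n (mulVar n j u) = u + mulVar n j (downMap n u) := by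
  suffices h : downMap n ∘ₗ mulVar n j = LinearMap.id + mulVar n j ∘ₗ downMap n from
    LinearMap.congr_fun h u
  refine Finsupp.lhom_ext' fun S => LinearMap.ext_ring ?_
  simp only [LinearMap.comp_apply, Finsupp.lsingle_apply, LinearMap.add_apply, LinearMap.id_apply,
    mulVar_single, downMap_single, map_sum]
  by_cases hj : j ∈ S
  · have hsum : ∑ k ∈ S, (if j ∈ S.erase k then (0 : Finset (Fin n) →₀ ZMod 2)
        else Finsupp.single (insert j (S.erase k)) 1) = Finsupp.single S 1 := by
      rw [Finset.sum_eq_single_of_mem j hj]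
      · simp [Finset.insert_erase hj]
      · intro k _ hk
        rw [if_pos (Finset.mem_erase.2 ⟨hk.symm, hj⟩)]
    rw [if_pos hj, map_zero, hsum, ← Finsupp.single_add, CharTwo.add_self_eq_zero,
      Finsupp.single_zero]
  · rw [if_neg hj, downMap_single, Finset.sum_insert hj, Finset.erase_insert hj]
    congr 1
    refine Finset.sum_congr rfl fun k hk => ?_
    have hjk : j ≠ k := fun h => hj (h ▸ hk)
    rw [if_neg fun h => hj (Finset.mem_of_mem_erase h), Finset.erase_insert_of_ne hjk]

theorem mapDomain_image_mulVar (n : ℕ) (g : Equiv.Perm (Fin n)) (j : Fin n)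
    (u : Finset (Fin n) →₀ ZMod 2) :
    Finsupp.mapDomain (fun S : Finset (Fin n) => S.image ⇑g) (mulVar n j u) =
      mulVar n (g j) (Finsupp.mapDomain (fun S : Finset (Fin n) => S.image ⇑g) u) := by
  suffices h : Finsupp.lmapDomain (ZMod 2) (ZMod 2) (fun S : Finset (Fin n) => S.image ⇑g) ∘ₗ
      mulVar n j = mulVar n (g j) ∘ₗ
      Finsupp.lmapDomain (ZMod 2) (ZMod 2) (fun S : Finset (Fin n) => S.image ⇑g) from
    LinearMap.congr_fun h u
  refine Finsupp.lhom_ext' fun S => LinearMap.ext_ring ?_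
  simp only [LinearMap.comp_apply, Finsupp.lsingle_apply, Finsupp.lmapDomain_apply,
    Finsupp.mapDomain_single, mulVar_single, g.injective.mem_finset_image]
  split_ifs
  · exact Finsupp.mapDomain_zero
  · rw [Finsupp.mapDomain_single, Finset.image_insert]

theorem IsHomogeneousDeg.mulVar {n i : ℕ} {u : Finset (Fin n) →₀ ZMod 2}
    (hu : IsHomogeneousDeg n i u) (j : Fin n) :
    IsHomogeneousDeg n (i + 1) (mulVar n j u) := by
  unfold IsHomogeneousDeg at hu ⊢
  induction hu using Submodule.span_induction with
  | mem f hf =>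
    obtain ⟨S, hS, rfl⟩ := hf
    rw [mulVar_single]
    split_ifs with hj
    · exact Submodule.zero_mem _
    · exact Submodule.subset_span ⟨_, by rw [Finset.card_insert_of_notMem hj, hS], rfl⟩
  | zero => rw [map_zero]; exact Submodule.zero_mem _
  | add f g _ _ hf hg => rw [map_add]; exact Submodule.add_mem _ hf hg
  | smul c f _ hf => rw [map_smul]; exact Submodule.smul_mem _ c hf

/-- (Theorem 2.7.) If some orbit of `G` on `Fin n` has odd cardinality, then the complex of
`G`-invariants `(C(𝔽₂)^G, D)` is acyclic: every invariant homogeneous cycle is the boundary of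
an invariant homogeneous element one degree higher. -/
theorem invariant_complex_acyclic_of_odd_orbit (n : ℕ) (G : Subgroup (Equiv.Perm (Fin n)))
    (hodd : ∃ x : Fin n, Odd (Nat.card (MulAction.orbit G x)))
    (i : ℕ) (u : Finset (Fin n) →₀ ZMod 2)
    (hinv : IsGInvariant n G u) (hhom : IsHomogeneousDeg n i u)
    (hcycle : downMap n u = 0) :
    ∃ v : Finset (Fin n) →₀ ZMod 2,
      IsGInvariant n G v ∧ IsHomogeneousDeg n (i + 1) v ∧ downMap n v = u := by
  classical
  obtain ⟨x, hx⟩ := hodd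
  rw [Nat.card_eq_card_toFinset] at hx
  refine ⟨∑ j ∈ (MulAction.orbit G x).toFinset, mulVar n j u, fun g hg => ?_,
    Submodule.sum_mem _ fun j _ => hhom.mulVar j, ?_⟩
  · rw [Finsupp.mapDomain_finsetSum]
    refine Finset.sum_equiv g (fun j => ?_) fun j _ => ?_
    · rw [Set.mem_toFinset, Set.mem_toFinset, ← MulAction.orbit_eq_iff, ← MulAction.orbit_eq_iff,
        ← MulAction.orbit_smul (⟨g, hg⟩ : G) j]
      rfl
    · rw [mapDomain_image_mulVar, hinv g hg]
  · simp only [map_sum, downMap_mulVar, hcycle, map_zero, add_zero, Finset.sum_const]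
    rw [← Nat.cast_smul_eq_nsmul (ZMod 2), ZMod.natCast_eq_one_iff_odd.2 hx, one_smul]
end

section
/- (Morse matching lemma, part (i).) Let F be a field, P a finite graded poset supporting a chain complex (C, d), and M a Morse matching on P such that d_{p,q} ≠ 0 whenever q = M(p) and q < p. Then for every i, dim_F ( ker d_i / range d_{i+1} ) ≤ the number of critical (unmatched) elements of P of rank i. -/
open scoped Classical

/-- A submodule of `P →₀ F` contains `f` as soon as it contains the basis vectors indexed by the
support of `f`. -/
theorem Finsupp.mem_of_forall_single_mem {F P : Type*} [Field F] (N : Submodule F (P →₀ F))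
    (f : P →₀ F) (h : ∀ q, f q ≠ 0 → Finsupp.single q (1 : F) ∈ N) : f ∈ N := by
  rw [← Finsupp.sum_single f]
  refine Submodule.sum_mem _ fun q hq => ?_
  have := N.smul_mem (f q) (h q (Finsupp.mem_support_iff.mp hq))
  simpa using this

theorem Finsupp.ne_and_ne_zero_of_erase_ne_zero {F P : Type*} [Zero F] {f : P →₀ F} {p q : P}
    (h : f.erase p q ≠ 0) : q ≠ p ∧ f q ≠ 0 := by
  have hqp : q ≠ p := by
    rintro rfl
    exact h Finsupp.erase_same
  exact ⟨hqp, by rwa [Finsupp.erase_ne hqp] at h⟩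

/-- In a finite poset, a function increasing by one along covers is strictly monotone. -/
theorem strictMono_of_covBy_eq_add_one {P : Type*} [Finite P] [PartialOrder P] (rk : P → ℕ)
    (hrk : ∀ p q : P, q ⋖ p → rk p = rk q + 1) : StrictMono rk := by
  have := Fintype.ofFinite P
  let : LocallyFiniteOrder P := Fintype.toLocallyFiniteOrder
  intro a b hab
  have h := transGen_covBy_of_lt hab
  clear hab
  induction h with
  | single h => have := hrk _ _ h; omega
  | tail _ h ih => have := hrk _ _ h; omega

/-- (Lemma 3.2(i), algebraic Morse theory.) Let `P` be a finite graded poset supporting a chain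
complex `(C, d)` over a field `F` (realized on the free module `P →₀ F`, graded by the rank
function `rk`), and let `M` (with domain `dom`) be an acyclic (Morse) matching on `P` such that
`d_{p, M p} ≠ 0` whenever `M p < p`.  Then the dimension of the degree-`i` homology
`ker dᵢ / im dᵢ₊₁` is at most the number of critical (unmatched) elements of rank `i`. -/
theorem morse_matching_homology_bound
    (F : Type*) [Field F] (P : Type*) [Fintype P] [DecidableEq P] [PartialOrder P]
    (rk : P → ℕ) (hrk : ∀ p q : P, q ⋖ p → rk p = rk q + 1)
    (d : (P →₀ F) →ₗ[F] (P →₀ F))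
    (hsupp : ∀ p q : P, d (Finsupp.single p 1) q ≠ 0 → q < p ∧ rk p = rk q + 1)
    (hdd : d.comp d = 0)
    (dom : Set P) (M : P → P)
    (hMdom : ∀ p ∈ dom, M p ∈ dom)
    (hMinv : ∀ p ∈ dom, M (M p) = p)
    (hMcov : ∀ p ∈ dom, M p ⋖ p ∨ p ⋖ M p)
    (hacyc : ∀ p : P, ¬ Relation.TransGen
      (fun x y : P =>
        (y ⋖ x ∧ ¬(x ∈ dom ∧ M x = y)) ∨ (x ⋖ y ∧ y ∈ dom ∧ M y = x)) p p)
    (hunit : ∀ p ∈ dom, M p < p → d (Finsupp.single p 1) (M p) ≠ 0)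
    (i : ℕ) :
    Module.finrank F
      ((Submodule.span F {f : P →₀ F | ∃ p : P, rk p = i ∧ f = Finsupp.single p 1} ⊓
          LinearMap.ker d).map
        (Submodule.map d
          (Submodule.span F
            {f : P →₀ F | ∃ p : P, rk p = i + 1 ∧ f = Finsupp.single p 1})).mkQ) ≤
      Fintype.card {p : P // p ∉ dom ∧ rk p = i} := by
  set r : P → P → Prop := fun x y =>
    (y ⋖ x ∧ ¬(x ∈ dom ∧ M x = y)) ∨ (x ⋖ y ∧ y ∈ dom ∧ M y = x)
  have hmono := strictMono_of_covBy_eq_add_one rk hrk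
  have hcov : ∀ p q : P, d (Finsupp.single p 1) q ≠ 0 → q ⋖ p := fun p q h => by
    obtain ⟨hlt, hrank⟩ := hsupp p q h
    refine ⟨hlt, fun z hqz hzp => ?_⟩
    have := hmono hqz
    have := hmono hzp
    omega
  have : IsTrans P (Relation.TransGen r) := ⟨fun _ _ _ => Relation.TransGen.trans⟩
  have : IsTrans P (Function.swap (Relation.TransGen r)) := ⟨fun _ _ _ h₁ h₂ => h₂.trans h₁⟩
  have : Std.Irrefl (Relation.TransGen r) := ⟨hacyc⟩
  have : Std.Irrefl (Function.swap (Relation.TransGen r)) := ⟨hacyc⟩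
  have hwf : WellFounded (Relation.TransGen r) := Finite.wellFounded_of_trans_of_irrefl _
  have hwf' : WellFounded (Function.swap (Relation.TransGen r)) :=
    Finite.wellFounded_of_trans_of_irrefl _
  have hspan : ∀ j, Submodule.span F {f : P →₀ F | ∃ p : P, rk p = j ∧ f = Finsupp.single p 1} =
      Finsupp.supported F F {p | rk p = j} := fun j => by
    rw [Finsupp.supported_eq_span_single]
    congr 1
    ext f
    simp [eq_comm]
  rw [hspan, hspan]
  set B := Submodule.map d (Finsupp.supported F F {p | rk p = i + 1})
  set S : Set P := {p | rk p = i ∧ ¬(p ∈ dom ∧ p < M p)}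
  -- Modulo boundaries, every basis vector can be pushed off the elements matched upwards.
  have hreduce : ∀ p, rk p = i → Finsupp.single p (1 : F) ∈ Finsupp.supported F F S ⊔ B := by
    intro p
    induction p using hwf'.induction with
    | _ p ih =>
      intro hp
      by_cases hup : p ∈ dom ∧ p < M p
      · obtain ⟨hpd, hlt⟩ := hup
        have hpM : p ⋖ M p := (hMcov p hpd).resolve_left fun h => lt_asymm h.lt hlt
        have hne : d (Finsupp.single (M p) 1) p ≠ 0 := by
          have := hunit (M p) (hMdom p hpd)
          rw [hMinv p hpd] at this
          exact this hlt
        have hrank := hrk _ _ hpM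
        set w := d (Finsupp.single (M p) 1)
        have hwB : w ∈ Finsupp.supported F F S ⊔ B := by
          refine Submodule.mem_sup_right (Submodule.mem_map_of_mem ?_)
          exact Finsupp.single_mem_supported F 1 (show rk (M p) = i + 1 by omega)
        have herase : w.erase p ∈ Finsupp.supported F F S ⊔ B := by
          refine Finsupp.mem_of_forall_single_mem _ _ fun q hq => ?_
          obtain ⟨hqp, hq⟩ := Finsupp.ne_and_ne_zero_of_erase_ne_zero hq
          have hrq := (hsupp _ _ hq).2
          refine ih q (Relation.TransGen.head (b := M p) ?_ (Relation.TransGen.single ?_))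
            (by omega)
          · exact Or.inr ⟨hpM, hMdom p hpd, hMinv p hpd⟩
          · refine Or.inl ⟨hcov _ _ hq, fun h => hqp ?_⟩
            rw [← h.2, hMinv p hpd]
        have hsub := Submodule.smul_mem _ (w p)⁻¹ (Submodule.sub_mem _ hwB herase)
        have heq : w - w.erase p = Finsupp.single p (w p) :=
          sub_eq_of_eq_add (Finsupp.single_add_erase p w).symm
        rw [heq] at hsub
        simpa [hne] using hsub
      · exact Submodule.mem_sup_left (Finsupp.single_mem_supported F 1 ⟨hp, hup⟩)
  -- A cycle supported off the upward matched elements is determined by its critical coefficients.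
  have hdet : ∀ f ∈ Finsupp.supported F F S ⊓ LinearMap.ker d,
      (∀ p, p ∉ dom → rk p = i → f p = 0) → f = 0 := by
    rintro f ⟨hfS, hfd⟩ hcrit
    ext p
    induction p using hwf.induction with
    | _ p ih =>
      by_contra hp
      rw [Finsupp.zero_apply] at hp
      obtain ⟨hpi, hup⟩ := (Finsupp.mem_supported F f).mp hfS (Finsupp.mem_support_iff.mpr hp)
      have hpd : p ∈ dom := by
        by_contra h
        exact hp (hcrit p h hpi)
      have hMp : M p ⋖ p := (hMcov p hpd).resolve_right fun h => hup ⟨hpd, h.lt⟩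
      have herase : f.erase p ∈ LinearMap.ker (Finsupp.lapply (M p) ∘ₗ d : (P →₀ F) →ₗ[F] F) := by
        refine Finsupp.mem_of_forall_single_mem _ _ fun q hq => ?_
        obtain ⟨hqp, hq⟩ := Finsupp.ne_and_ne_zero_of_erase_ne_zero hq
        by_contra hne
        refine hq (ih q (Relation.TransGen.head (b := M p) ?_ (Relation.TransGen.single ?_)))
        · refine Or.inl ⟨hcov q (M p) hne, fun h => hqp ?_⟩
          rw [← hMinv q h.1, h.2, hMinv p hpd]
        · exact Or.inr ⟨hMp, hpd, rfl⟩
      have hzero : d f (M p) = 0 := by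
        rw [LinearMap.mem_ker.mp hfd, Finsupp.zero_apply]
      have herase' : d (f.erase p) (M p) = 0 := herase
      rw [← Finsupp.single_add_erase p f, map_add, Finsupp.add_apply, herase', add_zero,
        ← mul_one (f p), ← smul_eq_mul, ← Finsupp.smul_single, map_smul, Finsupp.smul_apply,
        smul_eq_mul] at hzero
      exact (mul_ne_zero hp (hunit p hpd hMp.lt)) hzero
  set Z := Finsupp.supported F F S ⊓ LinearMap.ker d
  have hle : (Finsupp.supported F F {p | rk p = i} ⊓ LinearMap.ker d).map B.mkQ ≤
      Z.map B.mkQ := by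
    rintro _ ⟨z, ⟨hzi, hzd⟩, rfl⟩
    have hz : z ∈ Finsupp.supported F F S ⊔ B :=
      Finsupp.mem_of_forall_single_mem _ _ fun q hq => hreduce q
        ((Finsupp.mem_supported F z).mp hzi (Finsupp.mem_support_iff.mpr hq))
    obtain ⟨x, hx, b, hb, rfl⟩ := Submodule.mem_sup.mp hz
    have hdb : d b = 0 := by
      obtain ⟨c, -, rfl⟩ := hb
      exact LinearMap.congr_fun hdd c
    refine ⟨x, ⟨hx, ?_⟩, ?_⟩
    · simpa [hdb] using hzd
    · rw [map_add, show B.mkQ b = 0 from (Submodule.Quotient.mk_eq_zero B).mpr hb, add_zero]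
  let φ : Z →ₗ[F] ({p : P // p ∉ dom ∧ rk p = i} → F) :=
    LinearMap.pi fun p => Finsupp.lapply (p : P) ∘ₗ Z.subtype
  have hφ : Function.Injective φ := by
    intro f g hfg
    refine Subtype.ext (sub_eq_zero.mp (hdet _ (sub_mem f.2 g.2) fun p hp hpi => ?_))
    exact sub_eq_zero.mpr (congr_fun hfg ⟨p, hp, hpi⟩)
  calc _ ≤ Module.finrank F (Z.map B.mkQ) := Submodule.finrank_mono hle
    _ ≤ Module.finrank F Z := Submodule.finrank_map_le _ _
    _ ≤ Module.finrank F ({p : P // p ∉ dom ∧ rk p = i} → F) :=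
      LinearMap.finrank_le_finrank_of_injective hφ
    _ = _ := Module.finrank_fintype_fun_eq_card F
end

section
/- (Morse matching lemma, part (iii).) Let F be a field, P a finite graded poset supporting a chain complex (C, d), and M a Morse matching on P such that d_{p,q} ≠ 0 whenever q = M(p) and q < p. Suppose in addition that for every critical element p one has d_{q,p} = 0 for all q ∈ P and d_{p,r} = 0 for all r ∈ P (i.e. d(e_p) = 0 and e_p occurs with coefficient 0 in d(e_q) for every q). Then for each i, the images of {e_p : p critical, rk(p) = i} in ker d_i / range d_{i+1} form an F-basis of this homology space. -/
open scoped Classical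

namespace MorseMatching

/-- The edge relation of the Hasse diagram in which the edges matched by `M` are reversed. -/
def Edge {P : Type*} [PartialOrder P] (dom : Set P) (M : P → P) (x y : P) : Prop :=
  (y ⋖ x ∧ ¬(x ∈ dom ∧ M x = y)) ∨ (x ⋖ y ∧ y ∈ dom ∧ M y = x)

theorem wellFounded_transGen_of_acyclic {P : Type*} [Finite P] {r : P → P → Prop}
    (h : ∀ p, ¬ Relation.TransGen r p p) : WellFounded (Relation.TransGen r) :=
  haveI : Std.Irrefl (Relation.TransGen r) := ⟨h⟩
  Finite.wellFounded_of_trans_of_irrefl _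

theorem wellFounded_swap_transGen_of_acyclic {P : Type*} [Finite P] {r : P → P → Prop}
    (h : ∀ p, ¬ Relation.TransGen r p p) :
    WellFounded (Function.swap (Relation.TransGen r)) :=
  haveI : Std.Irrefl (Function.swap (Relation.TransGen r)) := ⟨h⟩
  haveI : IsTrans P (Function.swap (Relation.TransGen r)) := ⟨fun _ _ _ hab hbc => hbc.trans hab⟩
  Finite.wellFounded_of_trans_of_irrefl _

theorem linearMap_apply_eq_sum {F P : Type*} [Field F] [Fintype P]
    (d : (P →₀ F) →ₗ[F] (P →₀ F)) (z : P →₀ F) (x : P) :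
    d z x = ∑ q, z q * d (Finsupp.single q 1) x := by
  conv_lhs => rw [← Finsupp.univ_sum_single z]
  rw [map_sum, Finsupp.finsetSum_apply]
  refine Finset.sum_congr rfl fun q _ => ?_
  rw [← mul_one (z q), ← smul_eq_mul, ← Finsupp.smul_single, map_smul]
  simp

theorem strictMono_of_covBy_rank {P : Type*} [Finite P] [PartialOrder P] {rk : P → ℕ}
    (hrk : ∀ p q : P, q ⋖ p → rk p = rk q + 1) : StrictMono rk := by
  cases nonempty_fintype P
  let : LocallyFiniteOrder P := Fintype.toLocallyFiniteOrder
  exact (strictMono_iff_forall_covBy rk).2 fun a b h => by rw [hrk b a h]; exact Nat.lt_succ_self _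

theorem covBy_of_lt_of_rank {P : Type*} [Finite P] [PartialOrder P] {rk : P → ℕ}
    (hrk : ∀ p q : P, q ⋖ p → rk p = rk q + 1) {p q : P} (h : q < p)
    (h' : rk p = rk q + 1) : q ⋖ p := by
  refine ⟨h, fun r hqr hrp => ?_⟩
  have h₁ := strictMono_of_covBy_rank hrk hqr
  have h₂ := strictMono_of_covBy_rank hrk hrp
  omega

theorem supported_rank_eq_span (F : Type*) [Field F] {P : Type*} (rk : P → ℕ) (i : ℕ) :
    Submodule.span F {f : P →₀ F | ∃ p : P, rk p = i ∧ f = Finsupp.single p 1} =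
      Finsupp.supported F F {p | rk p = i} := by
  rw [Finsupp.supported_eq_span_single]
  congr 1
  ext f
  simp [eq_comm]

section

variable {F P : Type*} [Field F] [Fintype P] [PartialOrder P]
  {d : (P →₀ F) →ₗ[F] (P →₀ F)} {dom : Set P} {M : P → P}

/-- A cycle with no component on the lower elements of matched pairs has no component on the
upper ones either. -/
theorem apply_eq_zero_of_mem_ker
    (hcov : ∀ p q : P, d (Finsupp.single p 1) q ≠ 0 → q ⋖ p)
    (hMinv : ∀ p ∈ dom, M (M p) = p)
    (hMcov : ∀ p ∈ dom, M p ⋖ p ∨ p ⋖ M p)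
    (hacyc : ∀ p : P, ¬ Relation.TransGen (Edge dom M) p p)
    (hunit : ∀ p ∈ dom, M p < p → d (Finsupp.single p 1) (M p) ≠ 0)
    (hcrit : ∀ p ∉ dom, d (Finsupp.single p 1) = 0)
    {z : P →₀ F} (hz : d z = 0) (hlow : ∀ p ∈ dom, p < M p → z p = 0)
    {p : P} (hp : p ∈ dom) : z p = 0 := by
  induction p using (wellFounded_transGen_of_acyclic hacyc).induction with
  | _ p ih =>
    rcases hMcov p hp with hlt | hlt
    swap
    · exact hlow p hp hlt.lt
    have h := linearMap_apply_eq_sum d z (M p)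
    rw [hz, Finset.sum_eq_single p] at h
    · exact (mul_eq_zero.1 h.symm).resolve_right (hunit p hp hlt.lt)
    · intro q _ hqp
      by_cases hdq : d (Finsupp.single q 1) (M p) = 0
      · rw [hdq, mul_zero]
      have hq : q ∈ dom := by
        by_contra hq
        exact hdq (by rw [hcrit q hq]; rfl)
      have hMq : M q ≠ M p := fun e => hqp (by rw [← hMinv q hq, e, hMinv p hp])
      rw [ih q (.tail (.single (.inl ⟨hcov q _ hdq, fun h => hMq h.2⟩)) (.inr ⟨hlt, hp, rfl⟩)) hq,
        zero_mul]
    · simp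

/-- Modulo boundaries, every chain is equivalent to one with no component on the lower elements
of matched pairs. -/
theorem single_mem_supported_sup_map {rk : P → ℕ}
    (hrk : ∀ p q : P, q ⋖ p → rk p = rk q + 1)
    (hcov : ∀ p q : P, d (Finsupp.single p 1) q ≠ 0 → q ⋖ p)
    (hMdom : ∀ p ∈ dom, M p ∈ dom) (hMinv : ∀ p ∈ dom, M (M p) = p)
    (hMcov : ∀ p ∈ dom, M p ⋖ p ∨ p ⋖ M p)
    (hacyc : ∀ p : P, ¬ Relation.TransGen (Edge dom M) p p)
    (hunit : ∀ p ∈ dom, M p < p → d (Finsupp.single p 1) (M p) ≠ 0)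
    {i : ℕ} {p : P} (hp : rk p = i) :
    Finsupp.single p (1 : F) ∈
      Finsupp.supported F F {q | rk q = i ∧ ¬(q ∈ dom ∧ q < M q)} ⊔
        (Finsupp.supported F F {q | rk q = i + 1}).map d := by
  set S := Finsupp.supported F F {q | rk q = i ∧ ¬(q ∈ dom ∧ q < M q)} ⊔
    (Finsupp.supported F F {q | rk q = i + 1}).map d with hS
  induction p using (wellFounded_swap_transGen_of_acyclic hacyc).induction with
  | _ p ih =>
    by_cases hlow : p ∈ dom ∧ p < M p
    swap
    · exact Submodule.mem_sup_left (Finsupp.single_mem_supported F 1 ⟨hp, hlow⟩)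
    obtain ⟨hpd, hlt⟩ := hlow
    have hpM : p ⋖ M p := (hMcov p hpd).resolve_left fun h => lt_asymm h.lt hlt
    have hinv := hMinv p hpd
    have hc : d (Finsupp.single (M p) 1) p ≠ 0 := by
      have h := hunit (M p) (hMdom p hpd)
      rw [hinv] at h
      exact h hlt
    have hrkM := hrk _ _ hpM
    have hd : d (Finsupp.single (M p) 1) ∈ S :=
      Submodule.mem_sup_right (Submodule.mem_map_of_mem
        (Finsupp.single_mem_supported F 1 (by simp [hrkM, hp])))
    have hrest :
        ∑ q ∈ Finset.univ.erase p, Finsupp.single q (d (Finsupp.single (M p) 1) q) ∈ S := by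
      refine Submodule.sum_mem _ fun q hq => ?_
      by_cases hdq : d (Finsupp.single (M p) 1) q = 0
      · simp [hdq]
      have hqM := hcov _ _ hdq
      have hrkq := hrk _ _ hqM
      rw [← mul_one (d _ q), ← smul_eq_mul, ← Finsupp.smul_single]
      refine S.smul_mem _ (ih q ?_ (by omega))
      exact .tail (.single (.inr ⟨hpM, hMdom p hpd, hinv⟩))
        (.inl ⟨hqM, fun h => Finset.ne_of_mem_erase hq (by rw [← h.2, hinv])⟩)
    have hsum := Finsupp.univ_sum_single (d (Finsupp.single (M p) 1))
    rw [← Finset.add_sum_erase _ _ (Finset.mem_univ p)] at hsum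
    have hmem : Finsupp.single p (d (Finsupp.single (M p) 1) p) ∈ S := by
      rw [eq_sub_of_add_eq hsum]
      exact S.sub_mem hd hrest
    rw [← mul_one (d _ p), ← smul_eq_mul, ← Finsupp.smul_single] at hmem
    exact (S.smul_mem_iff hc).1 hmem

end

end MorseMatching

/-- (Lemma 3.2(iii), algebraic Morse theory.) With `P` a finite graded poset supporting `(C, d)`
and `M` a Morse matching with invertible matched coefficients, if moreover every critical
(unmatched) element `p` satisfies `d(e_p) = 0` and `d_{q,p} = 0` for all `q`, then the images of
the basis vectors `e_p`, for `p` critical of rank `i`, in `ker dᵢ / im dᵢ₊₁` (realized as the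
image of the cycle space in `C ⧸ im dᵢ₊₁`) form an `F`-basis of the homology:
they are linearly independent and they span that image. -/
theorem morse_matching_homology_basis
    (F : Type*) [Field F] (P : Type*) [Fintype P] [DecidableEq P] [PartialOrder P]
    (rk : P → ℕ) (hrk : ∀ p q : P, q ⋖ p → rk p = rk q + 1)
    (d : (P →₀ F) →ₗ[F] (P →₀ F))
    (hsupp : ∀ p q : P, d (Finsupp.single p 1) q ≠ 0 → q < p ∧ rk p = rk q + 1)
    (hdd : d.comp d = 0)
    (dom : Set P) (M : P → P)
    (hMdom : ∀ p ∈ dom, M p ∈ dom)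
    (hMinv : ∀ p ∈ dom, M (M p) = p)
    (hMcov : ∀ p ∈ dom, M p ⋖ p ∨ p ⋖ M p)
    (hacyc : ∀ p : P, ¬ Relation.TransGen
      (fun x y : P =>
        (y ⋖ x ∧ ¬(x ∈ dom ∧ M x = y)) ∨ (x ⋖ y ∧ y ∈ dom ∧ M y = x)) p p)
    (hunit : ∀ p ∈ dom, M p < p → d (Finsupp.single p 1) (M p) ≠ 0)
    (hcrit : ∀ p : P, p ∉ dom →
      d (Finsupp.single p 1) = 0 ∧ ∀ q : P, d (Finsupp.single q 1) p = 0)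
    (i : ℕ) :
    LinearIndependent F
      (fun p : {p : P // p ∉ dom ∧ rk p = i} =>
        (Submodule.Quotient.mk (Finsupp.single p.1 1) :
          (P →₀ F) ⧸ Submodule.map d
            (Submodule.span F
              {f : P →₀ F | ∃ p : P, rk p = i + 1 ∧ f = Finsupp.single p 1}))) ∧
    Submodule.span F
        (Set.range fun p : {p : P // p ∉ dom ∧ rk p = i} =>
          (Submodule.Quotient.mk (Finsupp.single p.1 1) :
            (P →₀ F) ⧸ Submodule.map d
              (Submodule.span F
                {f : P →₀ F | ∃ p : P, rk p = i + 1 ∧ f = Finsupp.single p 1}))) =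
      (Submodule.span F {f : P →₀ F | ∃ p : P, rk p = i ∧ f = Finsupp.single p 1} ⊓
          LinearMap.ker d).map
        (Submodule.map d
          (Submodule.span F
            {f : P →₀ F | ∃ p : P, rk p = i + 1 ∧ f = Finsupp.single p 1})).mkQ := by
  have hcov : ∀ p q : P, d (Finsupp.single p 1) q ≠ 0 → q ⋖ p := fun p q h =>
    MorseMatching.covBy_of_lt_of_rank hrk (hsupp p q h).1 (hsupp p q h).2
  have hdd' : ∀ x, d (d x) = 0 := fun x => LinearMap.congr_fun hdd x
  rw [MorseMatching.supported_rank_eq_span F rk (i + 1),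
    MorseMatching.supported_rank_eq_span F rk i]
  refine ⟨?_, le_antisymm ?_ ?_⟩
  · rw [Fintype.linearIndependent_iff]
    intro g hg p
    have hg' : Submodule.Quotient.mk
        (p := (Finsupp.supported F F {q | rk q = i + 1}).map d)
        (∑ q : {p : P // p ∉ dom ∧ rk p = i}, g q • Finsupp.single q.1 1) = 0 := by
      simpa only [← Submodule.mkQ_apply, map_sum, map_smul] using hg
    obtain ⟨x, -, hx⟩ := (Submodule.Quotient.mk_eq_zero _).1 hg'
    have h := DFunLike.congr_fun hx p.1
    rw [MorseMatching.linearMap_apply_eq_sum, Finset.sum_eq_zero fun q _ => by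
      rw [(hcrit p.1 p.2.1).2 q, mul_zero], Finsupp.finsetSum_apply,
      Finset.sum_eq_single p] at h
    · simpa using h.symm
    · intro q _ hq
      simp [Subtype.coe_injective.ne hq]
    · simp
  · rw [Submodule.span_le]
    rintro _ ⟨p, rfl⟩
    exact Submodule.mem_map_of_mem
      ⟨Finsupp.single_mem_supported F 1 p.2.2, (hcrit p.1 p.2.1).1⟩
  · rintro _ ⟨z, ⟨hz, hdz⟩, rfl⟩
    have hz' : z ∈ Finsupp.supported F F {q | rk q = i ∧ ¬(q ∈ dom ∧ q < M q)} ⊔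
        (Finsupp.supported F F {q | rk q = i + 1}).map d := by
      rw [SetLike.mem_coe, Finsupp.supported_eq_span_single] at hz
      refine Submodule.span_le.2 ?_ hz
      rintro _ ⟨p, hp, rfl⟩
      exact MorseMatching.single_mem_supported_sup_map hrk hcov hMdom hMinv hMcov hacyc hunit hp
    obtain ⟨v, hv, b, ⟨y, hy, rfl⟩, rfl⟩ := Submodule.mem_sup.1 hz'
    have hdv : d v = 0 := by simpa [hdd'] using hdz
    rw [Finsupp.mem_supported'] at hv
    have hv₀ : ∀ p ∈ dom, v p = 0 := fun p hp =>
      MorseMatching.apply_eq_zero_of_mem_ker hcov hMinv hMcov hacyc hunit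
        (fun p hp => (hcrit p hp).1) hdv (fun p hp hlt => hv p fun h => h.2 ⟨hp, hlt⟩) hp
    have hb : Submodule.mkQ ((Finsupp.supported F F {q | rk q = i + 1}).map d) (d y) = 0 :=
      (Submodule.Quotient.mk_eq_zero _).2 (Submodule.mem_map_of_mem hy)
    rw [map_add, hb, add_zero, ← Finsupp.univ_sum_single v, map_sum]
    refine Submodule.sum_mem _ fun p _ => ?_
    by_cases hp : p ∉ dom ∧ rk p = i
    · rw [← mul_one (v p), ← smul_eq_mul, ← Finsupp.smul_single, map_smul]
      exact Submodule.smul_mem _ _ (Submodule.subset_span ⟨⟨p, hp⟩, rfl⟩)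
    · have : v p = 0 := by
        by_cases hpd : p ∈ dom
        · exact hv₀ p hpd
        · exact hv p fun h => hp ⟨hpd, h.1⟩
      simp [this]
end

section
/- Let k, ℓ be positive integers, let λ = (λ_1 ≥ λ_2 ≥ … ≥ λ_k ≥ 0) be a partition with λ_1 ≤ ℓ, and let i be an index with λ_i ≥ 1 such that the sequence μ obtained from λ by replacing λ_i with λ_i − 1 is still weakly decreasing. Then the number of subsets T of Fin k × Fin ℓ such that T contains the diagram D(μ) and the multiset of row sizes of T equals the multiset {λ_1, …, λ_k} is exactly (ℓ − λ_i + 1)·(m + 1), where m = #{j ∈ {1,…,k} : λ_j = λ_i − 1}. -/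
/-- Updating one value of a function exchanges one element of its multiset of values. -/
theorem map_update_add_singleton {α β : Type*} [Fintype α] [DecidableEq α] (f : α → β) (a : α)
    (v : β) :
    Multiset.map (Function.update f a v) Finset.univ.val + {f a} =
      Multiset.map f Finset.univ.val + {v} := by
  have key : ∀ g : α → β, Multiset.map g Finset.univ.val =
      g a ::ₘ Multiset.map g (Finset.univ.erase a).val := by
    intro g
    rw [← Finset.insert_erase (Finset.mem_univ a),
      Finset.insert_val_of_notMem (Finset.notMem_erase a _), Multiset.map_cons,
      Finset.erase_insert_eq_erase, Finset.erase_idem]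
  have rest : Multiset.map (Function.update f a v) (Finset.univ.erase a).val =
      Multiset.map f (Finset.univ.erase a).val := by
    refine Multiset.map_congr rfl fun x hx => ?_
    rw [Function.update_of_ne (Finset.ne_of_mem_erase hx)]
  rw [key, key f, rest, Function.update_self, ← Multiset.singleton_add, ← Multiset.singleton_add]
  abel

/-- Incrementing a function at two different places yields the same multiset of values exactly
when the incremented values agree. -/
theorem map_update_succ_eq_iff {α : Type*} [Fintype α] [DecidableEq α] (f : α → ℕ) (a b : α) :
    Multiset.map (Function.update f a (f a + 1)) Finset.univ.val =
      Multiset.map (Function.update f b (f b + 1)) Finset.univ.val ↔ f a = f b := by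
  have ha := map_update_add_singleton f a (f a + 1)
  have hb := map_update_add_singleton f b (f b + 1)
  constructor
  · intro h
    rw [h] at ha
    have hab : Multiset.map f Finset.univ.val + ({f a + 1} + {f b}) =
        Multiset.map f Finset.univ.val + ({f b + 1} + {f a}) := by
      rw [← add_assoc, ← add_assoc, ← ha, ← hb]
      abel
    have hmem : f a + 1 ∈ ({f b + 1} + {f a} : Multiset ℕ) := by
      rw [← add_left_cancel hab]
      simp
    simpa using hmem
  · intro h
    rw [h] at ha
    refine add_right_cancel (b := ({f b} : Multiset ℕ)) ?_
    rw [hb, ← ha, h]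

/-- The rows of the diagram of `μ` have sizes given by `μ`. -/
theorem card_row_diagram {k ℓ : ℕ} (μ : Fin k → ℕ) (hμ : ∀ a, μ a ≤ ℓ) (a : Fin k) :
    ((Finset.univ.filter fun p : Fin k × Fin ℓ => (p.2 : ℕ) < μ p.1).filter
      fun p => p.1 = a).card = μ a := by
  have h : ((Finset.univ.filter fun p : Fin k × Fin ℓ => (p.2 : ℕ) < μ p.1).filter
      fun p => p.1 = a) = {a} ×ˢ (Finset.univ.filter fun b : Fin ℓ => (b : ℕ) < μ a) := by
    ext ⟨x, y⟩
    simp only [Finset.mem_filter, Finset.mem_univ, true_and, Finset.mem_product,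
      Finset.mem_singleton]
    grind
  rw [h, Finset.card_product, Finset.card_singleton, one_mul, Fin.card_filter_val_lt,
    min_eq_right (hμ a)]

/-- Adding a new box increments the size of its row. -/
theorem card_row_insert {α β : Type*} [DecidableEq α] [DecidableEq β] (D : Finset (α × β))
    {p : α × β} (hp : p ∉ D) :
    (fun a => ((insert p D).filter fun q => q.1 = a).card) =
      Function.update (fun a => (D.filter fun q => q.1 = a).card) p.1
        ((D.filter fun q => q.1 = p.1).card + 1) := by
  funext a
  rw [Finset.filter_insert]
  by_cases h : p.1 = a
  · subst h
    rw [if_pos rfl, Finset.card_insert_of_notMem (by simp [hp]), Function.update_self]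
  · rw [if_neg h, Function.update_of_ne (Ne.symm h)]

/-- The size of a set of boxes is the sum of its multiset of row sizes. -/
theorem sum_map_card_row {α β : Type*} [Fintype α] [DecidableEq α] (T : Finset (α × β)) :
    (Multiset.map (fun a => (T.filter fun p => p.1 = a).card) Finset.univ.val).sum = T.card :=
  (Finset.card_eq_sum_card_fiberwise (fun _ _ => Finset.mem_coe.2 (Finset.mem_univ _))).symm

/-- The sets containing the diagram of `μ` and having the row sizes of `μ` incremented at `i`
are obtained by adding one box to a row of the same length as row `i`. -/
theorem filter_diagram_subset_eq_image {k ℓ : ℕ} (μ : Fin k → ℕ) (hμ : ∀ a, μ a ≤ ℓ)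
    (i : Fin k) :
    (Finset.univ.filter fun T : Finset (Fin k × Fin ℓ) =>
        (Finset.univ.filter fun p : Fin k × Fin ℓ => (p.2 : ℕ) < μ p.1) ⊆ T ∧
        Multiset.map (fun a : Fin k => (T.filter fun p => p.1 = a).card) Finset.univ.val =
          Multiset.map (Function.update μ i (μ i + 1)) Finset.univ.val) =
      ((Finset.univ.filter fun a => μ a = μ i) ×ˢ
        (Finset.univ.filter fun b : Fin ℓ => μ i ≤ b)).image fun p =>
          insert p (Finset.univ.filter fun p : Fin k × Fin ℓ => (p.2 : ℕ) < μ p.1) := by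
  set D := Finset.univ.filter fun p : Fin k × Fin ℓ => (p.2 : ℕ) < μ p.1 with hD
  have hrow : (fun a => (D.filter fun q => q.1 = a).card) = μ :=
    funext (card_row_diagram μ hμ)
  have hins : ∀ p, p ∉ D → (fun a => ((insert p D).filter fun q => q.1 = a).card) =
      Function.update μ p.1 (μ p.1 + 1) := by
    intro p hp
    rw [card_row_insert D hp, hrow, congrFun hrow p.1]
  ext T
  simp only [Finset.mem_filter, Finset.mem_univ, true_and, Finset.mem_image, Finset.mem_product]
  constructor
  · rintro ⟨hsub, hT⟩
    have hcard : T.card = D.card + 1 := by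
      have h := congrArg Multiset.sum (map_update_add_singleton μ i (μ i + 1))
      have hDs := sum_map_card_row D
      rw [hrow] at hDs
      rw [Multiset.sum_add, Multiset.sum_add, ← hT, sum_map_card_row, hDs,
        Multiset.sum_singleton, Multiset.sum_singleton] at h
      omega
    obtain ⟨p, hp, rfl⟩ := (Finset.covBy_iff_exists_insert.1
      (Finset.covBy_iff_card_sdiff_eq_one.2 ⟨hsub, by
        rw [Finset.card_sdiff_of_subset hsub]; omega⟩))
    rw [hins p hp, map_update_succ_eq_iff] at hT
    refine ⟨p, ⟨hT, ?_⟩, rfl⟩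
    simpa [hD, hT] using hp
  · rintro ⟨p, ⟨h1, h2⟩, rfl⟩
    have hp : p ∉ D := by simpa [hD, h1] using h2
    exact ⟨Finset.subset_insert _ _, by rw [hins p hp, map_update_succ_eq_iff, h1]⟩

/-- (Proposition 4.1.) The boundary coefficient `D_{λ,μ}` in the invariant complex for the
wreath product `𝔖_ℓ ≀ 𝔖_k` acting on the boxes of the `k × ℓ` rectangle: if `μ` is obtained
from `λ` by reducing the part `λᵢ` to `λᵢ − 1`, then the number of subsets `T` of the rectangle
containing the diagram of `μ` whose multiset of row sizes is `{λ₁, …, λ_k}` equals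
`(ℓ − λᵢ + 1) · (mult_λ(λᵢ − 1) + 1)`. -/
theorem wreath_boundary_coefficient (k ℓ : ℕ) (hk : 0 < k) (hℓ : 0 < ℓ)
    (lam : Fin k → ℕ)
    (hdec : ∀ i j : Fin k, i ≤ j → lam j ≤ lam i) (hbound : ∀ i : Fin k, lam i ≤ ℓ)
    (i : Fin k) (hpos : 1 ≤ lam i)
    (hmu : ∀ a b : Fin k, a ≤ b →
      Function.update lam i (lam i - 1) b ≤ Function.update lam i (lam i - 1) a) :
    (Finset.univ.filter fun T : Finset (Fin k × Fin ℓ) =>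
        (Finset.univ.filter fun p : Fin k × Fin ℓ =>
            (p.2 : ℕ) < Function.update lam i (lam i - 1) p.1) ⊆ T ∧
        Multiset.map (fun a : Fin k => (T.filter fun p => p.1 = a).card) Finset.univ.val =
          Multiset.map lam Finset.univ.val).card =
      (ℓ - lam i + 1) * ((Finset.univ.filter fun j : Fin k => lam j = lam i - 1).card + 1) := by
  obtain ⟨μ, hμ⟩ : ∃ μ, μ = Function.update lam i (lam i - 1) := ⟨_, rfl⟩
  have hμi : μ i = lam i - 1 := by rw [hμ, Function.update_self]
  have hlam : lam = Function.update μ i (μ i + 1) := by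
    rw [hμi, hμ, Function.update_idem, Nat.sub_add_cancel hpos, Function.update_eq_self]
  have hle : ∀ a, μ a ≤ ℓ := by
    intro a
    have := hbound a
    rw [hμ, Function.update_apply]
    split_ifs with h
    · subst h; omega
    · exact this
  have hrows : (Finset.univ.filter fun a => μ a = μ i) =
      insert i (Finset.univ.filter fun j => lam j = lam i - 1) := by
    ext a
    simp only [Finset.mem_filter, Finset.mem_univ, true_and, Finset.mem_insert, hμi]
    by_cases h : a = i
    · simp [h, hμi]
    · simp [h, hμ]
  have hcols : (Finset.univ.filter fun b : Fin ℓ => μ i ≤ b).card = ℓ - lam i + 1 := by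
    have hsplit := Finset.card_filter_add_card_filter_not (s := (Finset.univ : Finset (Fin ℓ)))
      fun b => (b : ℕ) < μ i
    simp only [not_lt, Fin.card_filter_val_lt, Finset.card_univ, Fintype.card_fin] at hsplit
    have := hbound i
    omega
  have hfilter := filter_diagram_subset_eq_image μ hle i
  rw [← hlam] at hfilter
  rw [← hμ, hfilter, Finset.card_image_of_injOn, Finset.card_product, hcols, hrows,
    Finset.card_insert_of_notMem, mul_comm]
  · simp only [Finset.mem_filter, Finset.mem_univ, true_and]
    omega
  · intro p hp q _ hpq
    have hmem : p ∈ insert q (Finset.univ.filter fun p : Fin k × Fin ℓ => (p.2 : ℕ) < μ p.1) :=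
      hpq.subset (Finset.mem_insert_self _ _)
    simp only [Finset.coe_product, Finset.coe_filter, Finset.mem_univ, true_and, Set.mem_prod,
      Set.mem_ofPred_eq] at hp
    rcases Finset.mem_insert.1 hmem with h | h
    · exact h
    · have := (Finset.mem_filter.1 h).2
      omega
end

section
/- Let n be a positive even integer and let G be a subgroup of Equiv.Perm (Fin n) that acts transitively on Fin n and has no self-complementary orbit on the (n/2)-element subsets of Fin n. Then the homology of (C(𝔽₂)^G, D) is not concentrated in even degrees: there exist an odd natural number i and a G-invariant element u of C, homogeneous of degree i, with D u = 0, such that u ≠ D v for every G-invariant v homogeneous of degree i+1. -/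
open MulAction Pointwise

namespace DownMap

variable {n : ℕ} {G : Subgroup (Equiv.Perm (Fin n))}

lemma downMap_apply (u : Finset (Fin n) →₀ ZMod 2) (T : Finset (Fin n)) :
    downMap n u T = ∑ j ∈ Tᶜ, u (insert j T) := by
  induction u using Finsupp.induction_linear with
  | zero => simp
  | add u v hu hv => simp [hu, hv, Finset.sum_add_distrib]
  | single S a =>
    simp only [downMap, Finsupp.lift_apply, Finsupp.sum_single_index, zero_smul,
      Finsupp.smul_apply, Finsupp.finsetSum_apply, Finsupp.single_apply, smul_eq_mul,
      Finset.mul_sum, mul_ite, mul_one, mul_zero]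
    rw [← Finset.sum_filter, ← Finset.sum_filter]
    refine Finset.sum_congr ?_ fun _ _ => rfl
    ext j
    simp only [Finset.mem_filter, Finset.mem_compl]
    constructor
    · rintro ⟨hj, rfl⟩
      simp [hj]
    · rintro ⟨hj, rfl⟩
      simp [hj]

lemma downMap_downMap (u : Finset (Fin n) →₀ ZMod 2) : downMap n (downMap n u) = 0 := by
  ext T
  simp only [downMap_apply, Finsupp.zero_apply]
  rw [Finset.sum_sigma']
  refine Finset.sum_involution (fun p _ => ⟨p.2, p.1⟩) ?_ ?_ ?_ ?_
  · rintro ⟨j, k⟩ -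
    simp only [Finset.insert_comm k j]
    exact CharTwo.add_self_eq_zero _
  · rintro ⟨j, k⟩ h - he
    simp only [Sigma.mk.injEq, heq_eq_eq] at he
    simp [he.1] at h
  · rintro ⟨j, k⟩ h
    simp only [Finset.mem_sigma, Finset.mem_compl, Finset.mem_insert, not_or] at h ⊢
    exact ⟨h.2.2, fun e => h.2.1 e.symm, h.1⟩
  · rintro ⟨j, k⟩ -
    rfl

lemma isGInvariant_iff {u : Finset (Fin n) →₀ ZMod 2} :
    IsGInvariant n G u ↔ ∀ g : G, ∀ S : Finset (Fin n), u (g • S) = u S := by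
  constructor
  · intro h g S
    conv_lhs => rw [← h g g.2]
    exact Finsupp.mapDomain_apply (Finset.image_injective (g : Equiv.Perm (Fin n)).injective) u S
  · intro h g hg
    ext T
    obtain ⟨S, rfl⟩ : ∃ S : Finset (Fin n), T = S.image g :=
      ⟨T.image ⇑g⁻¹, by ext x; simp [Finset.mem_image]⟩
    rw [Finsupp.mapDomain_apply (Finset.image_injective g.injective) u S]
    exact (h ⟨g, hg⟩ S).symm

lemma isHomogeneousDeg_iff {i : ℕ} {u : Finset (Fin n) →₀ ZMod 2} :
    IsHomogeneousDeg n i u ↔ ∀ S, u S ≠ 0 → S.card = i := by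
  have : {f : Finset (Fin n) →₀ ZMod 2 | ∃ S : Finset (Fin n), S.card = i ∧
      f = Finsupp.single S (1 : ZMod 2)} =
      (fun S => Finsupp.single S (1 : ZMod 2)) '' {S | S.card = i} := by
    ext f
    simp [eq_comm]
  rw [IsHomogeneousDeg, this, ← Finsupp.supported_eq_span_single, Finsupp.mem_supported]
  simp [Set.subset_def]

lemma isGInvariant_downMap {u : Finset (Fin n) →₀ ZMod 2} (hu : IsGInvariant n G u) :
    IsGInvariant n G (downMap n u) := by
  rw [isGInvariant_iff] at hu ⊢
  intro g S
  rw [downMap_apply, downMap_apply]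
  symm
  refine Finset.sum_bij (fun j _ => g • j) ?_ ?_ ?_ ?_
  · intro j hj
    simpa using hj
  · intro a _ b _ h
    exact smul_left_cancel g h
  · intro b hb
    refine ⟨g⁻¹ • b, ?_, smul_inv_smul g b⟩
    rwa [Finset.mem_compl, Finset.inv_smul_mem_iff, ← Finset.mem_compl]
  · intro j _
    rw [← Finset.smul_finset_insert, hu]

variable (G) in
/-- The `G`-invariant elements of `C` supported on sets whose size satisfies `P`. -/
def invariantsOn (P : ℕ → Prop) : Submodule (ZMod 2) (Finset (Fin n) →₀ ZMod 2) where
  carrier := {u | (∀ g : G, ∀ S : Finset (Fin n), u (g • S) = u S) ∧ ∀ S, ¬ P S.card → u S = 0}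
  add_mem' := by
    rintro u v ⟨hu, hu'⟩ ⟨hv, hv'⟩
    exact ⟨fun g S => by simp [hu, hv], fun S hS => by simp [hu' S hS, hv' S hS]⟩
  zero_mem' := by simp
  smul_mem' := by
    rintro c u ⟨hu, hu'⟩
    exact ⟨fun g S => by simp [hu], fun S hS => by simp [hu' S hS]⟩

lemma downMap_mem_invariantsOn {P Q : ℕ → Prop} (hPQ : ∀ k, P (k + 1) → Q k)
    {u : Finset (Fin n) →₀ ZMod 2} (hu : u ∈ invariantsOn G P) :
    downMap n u ∈ invariantsOn G Q := by
  refine ⟨isGInvariant_iff.1 (isGInvariant_downMap (isGInvariant_iff.2 hu.1)), fun S hS => ?_⟩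
  rw [downMap_apply]
  refine Finset.sum_eq_zero fun j hj => hu.2 _ fun h => hS (hPQ _ ?_)
  rwa [Finset.card_insert_of_notMem (Finset.mem_compl.1 hj)] at h

variable (G) in
/-- The sets whose size satisfies `P`, with their `G`-action. -/
def setsOn (P : ℕ → Prop) : SubMulAction G (Finset (Fin n)) where
  carrier := {S | P S.card}
  smul_mem' g S hS := by simpa using hS

lemma finrank_invariantsOn (P : ℕ → Prop) :
    Module.finrank (ZMod 2) (invariantsOn G P) =
      Nat.card (Quotient (orbitRel G (setsOn G P))) := by
  classical
  let φ : (Quotient (orbitRel G (setsOn G P)) → ZMod 2) →ₗ[ZMod 2]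
      (Finset (Fin n) →₀ ZMod 2) :=
    { toFun f := Finsupp.equivFunOnFinite.symm fun S =>
        if h : P S.card then f (Quotient.mk _ ⟨S, h⟩) else 0
      map_add' f f' := by
        ext S
        by_cases h : P S.card <;> simp [h]
      map_smul' c f := by
        ext S
        by_cases h : P S.card <;> simp [h] }
  have hφ (f) (S : setsOn G P) : φ f S = f (Quotient.mk _ S) := dif_pos S.2
  have hφ' (f) (S : Finset (Fin n)) (hS : ¬ P S.card) : φ f S = 0 := dif_neg hS
  have hinj : Function.Injective φ := by
    intro f f' hff'
    ext q
    induction q using Quotient.inductionOn with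
    | h S => simpa only [hφ] using DFunLike.congr_fun hff' (S : Finset (Fin n))
  have hrange : LinearMap.range φ = invariantsOn G P := by
    apply le_antisymm
    · rintro _ ⟨f, rfl⟩
      refine ⟨fun g S => ?_, hφ' f⟩
      by_cases hS : P S.card
      · rw [show g • S = ((g • (⟨S, hS⟩ : setsOn G P) : setsOn G P) : Finset (Fin n)) from rfl,
          hφ, hφ f ⟨S, hS⟩]
        exact congrArg f (Quotient.sound ⟨g, rfl⟩)
      · have hS' : ¬ P (g • S).card := by simpa using hS
        rw [hφ' f _ hS', hφ' f _ hS]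
    · intro u hu
      refine ⟨Quotient.lift (fun S : setsOn G P => u S) ?_, ?_⟩
      · rintro _ S ⟨g, rfl⟩
        exact hu.1 g S
      · ext S
        by_cases hS : P S.card
        · exact hφ _ ⟨S, hS⟩
        · exact (hφ' _ S hS).trans (hu.2 S hS).symm
  rw [← hrange, LinearMap.finrank_range_of_inj hinj, Module.finrank_fintype_fun_eq_card,
    Nat.card_eq_fintype_card]

/-- A permutation with no set mapped onto its complement has a cycle of odd length. -/
lemma exists_odd_zpow_apply_eq {α : Type*} [Fintype α] [DecidableEq α] (g : Equiv.Perm α)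
    (h : ∀ S : Finset α, S.image g ≠ Sᶜ) : ∃ x, ∃ k : ℤ, Odd k ∧ (g ^ k) x = x := by
  classical
  by_contra! hodd
  let r : α → α := fun x => (Quotient.mk (Equiv.Perm.SameCycle.setoid g) x).out
  have hr (x : α) : ∃ k : ℤ, (g ^ k) (r x) = x :=
    Quotient.exact (Quotient.out_eq (Quotient.mk (Equiv.Perm.SameCycle.setoid g) x))
  have hrg (x : α) : r (g x) = r x :=
    congrArg Quotient.out (Quotient.sound
      ((Equiv.Perm.sameCycle_apply_left (f := g)).2 (Equiv.Perm.SameCycle.refl g x)))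
  have huniq (x : α) {k m : ℤ} (hk : (g ^ k) (r x) = x) (hm : (g ^ m) (r x) = x) :
      ¬ Odd (k - m) := by
    intro ho
    refine hodd x (k - m) ho ?_
    conv_lhs => rw [← hm]
    rw [← Equiv.Perm.mul_apply, ← zpow_add]
    simpa using hk
  refine h {x | ∃ k : ℤ, Even k ∧ (g ^ k) (r x) = x} ?_
  ext y
  obtain ⟨x, rfl⟩ := g.surjective y
  simp only [Finset.mem_image, EmbeddingLike.apply_eq_iff_eq, exists_eq_right,
    Finset.mem_filter_univ, Finset.mem_compl, hrg]
  have hs (k : ℤ) (hk : (g ^ k) (r x) = x) : (g ^ (k + 1)) (r (g x)) = g x := by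
    rw [hrg, add_comm, zpow_add, Equiv.Perm.mul_apply, hk, zpow_one]
  constructor
  · rintro ⟨k, hke, hk⟩ ⟨m, hme, hm⟩
    exact huniq (g x) (hs k hk) (by rwa [hrg]) (by grind)
  · intro hx
    obtain ⟨k, hk⟩ := hr x
    refine ⟨k, ?_, hk⟩
    by_contra hke
    exact hx ⟨k + 1, by grind, hrg x ▸ hs k hk⟩

lemma exists_odd_card_smul_eq {α : Type*} [Fintype α] [DecidableEq α] (g : Equiv.Perm α)
    (h : ∀ S : Finset α, S.image g ≠ Sᶜ) : ∃ T : Finset α, Odd T.card ∧ g • T = T := by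
  classical
  obtain ⟨x, k, hk, hx⟩ := exists_odd_zpow_apply_eq g h
  refine ⟨(orbit (Subgroup.zpowers g) x).toFinset, ?_, ?_⟩
  · rw [Set.toFinset_card, ← minimalPeriod_eq_card]
    obtain ⟨c, rfl⟩ : (Function.minimalPeriod (g • ·) x : ℤ) ∣ k :=
      zpow_smul_eq_iff_minimalPeriod_dvd.1 hx
    exact_mod_cast (Int.odd_mul.1 hk).1
  · apply Finset.coe_injective
    rw [Finset.coe_smul_finset, Set.coe_toFinset]
    exact smul_orbit (⟨g, Subgroup.mem_zpowers g⟩ : Subgroup.zpowers g) x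

lemma card_orbits_even_eq_odd (h : ∀ g ∈ G, ∀ S : Finset (Fin n), S.image g ≠ Sᶜ) :
    Nat.card (Quotient (orbitRel G (setsOn G Even))) =
      Nat.card (Quotient (orbitRel G (setsOn G Odd))) := by
  classical
  have burnside (P : ℕ → Prop) := sum_card_fixedBy_eq_card_orbits_mul_card_group G (setsOn G P)
  have hfix (g : G) : Fintype.card (fixedBy (setsOn G Even) g) =
      Fintype.card (fixedBy (setsOn G Odd) g) := by
    obtain ⟨T, hT, hgT⟩ := exists_odd_card_smul_eq (g : Equiv.Perm (Fin n)) (h g g.2)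
    have hcard (S : Finset (Fin n)) : Even (symmDiff S T).card ↔ Odd S.card := by
      have h1 := Finset.card_sdiff_add_card_inter S T
      have h2 := Finset.card_sdiff_add_card_inter T S
      have h3 : (symmDiff S T).card = (S \ T).card + (T \ S).card :=
        Finset.card_union_of_disjoint disjoint_sdiff_sdiff
      rw [Finset.inter_comm] at h2
      grind
    have hsmul (S : Finset (Fin n)) (hS : g • S = S) : g • symmDiff S T = symmDiff S T := by
      rw [Finset.smul_finset_symmDiff, hS]
      exact congrArg _ hgT
    refine Fintype.card_congr ⟨
      fun S => ⟨⟨symmDiff S.1.1 T, ?_⟩, Subtype.ext (hsmul _ (congrArg Subtype.val S.2))⟩,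
      fun S => ⟨⟨symmDiff S.1.1 T, ?_⟩, Subtype.ext (hsmul _ (congrArg Subtype.val S.2))⟩,
      fun S => ?_, fun S => ?_⟩
    · have hS : Even S.1.1.card := S.1.2
      refine Nat.not_even_iff_odd.1 fun hc => ?_
      exact Nat.not_even_iff_odd.2 ((hcard _).1 hc) hS
    · exact (hcard _).2 S.1.2
    · simp
    · simp
  rw [Nat.card_eq_fintype_card, Nat.card_eq_fintype_card]
  refine Nat.eq_of_mul_eq_mul_right (Fintype.card_pos (α := G)) ?_
  rw [← burnside, ← burnside]
  exact Finset.sum_congr rfl fun g _ => hfix g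

/-- In a two-periodic complex whose two terms have the same dimension, exactness at one term
implies exactness at the other. -/
lemma exact_of_exact_of_finrank_eq {K E O : Type*} [Field K] [AddCommGroup E] [Module K E]
    [AddCommGroup O] [Module K O] [FiniteDimensional K E] [FiniteDimensional K O]
    (f : E →ₗ[K] O) (g : O →ₗ[K] E) (hEO : Module.finrank K E = Module.finrank K O)
    (hfg : f ∘ₗ g = 0) (hO : LinearMap.ker g = LinearMap.range f) :
    LinearMap.ker f = LinearMap.range g := by
  symm
  refine Submodule.eq_of_le_of_finrank_eq (LinearMap.range_le_ker_iff.2 hfg) ?_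
  have h1 := f.finrank_range_add_finrank_ker
  have h2 := g.finrank_range_add_finrank_ker
  rw [hO] at h2
  omega

lemma downMap_apply_empty (hev : Even n) (htrans : ∀ x y : Fin n, ∃ g ∈ G, g x = y)
    {u : Finset (Fin n) →₀ ZMod 2} (hu : IsGInvariant n G u) : downMap n u ∅ = 0 := by
  rw [isGInvariant_iff] at hu
  rcases n.eq_zero_or_pos with rfl | hn
  · simp [downMap_apply]
  have hconst (j : Fin n) : u {j} = u {⟨0, hn⟩} := by
    obtain ⟨g, hg, rfl⟩ := htrans ⟨0, hn⟩ j
    rw [← hu ⟨g, hg⟩ {⟨0, hn⟩}, Finset.smul_finset_singleton]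
    rfl
  simp [downMap_apply, hconst, (ZMod.natCast_eq_zero_iff_even).2 hev]

lemma exists_downMap_eq_of_homogeneous
    (h : ∀ i, Odd i → ∀ u, IsGInvariant n G u → IsHomogeneousDeg n i u → downMap n u = 0 →
      ∃ v, IsGInvariant n G v ∧ IsHomogeneousDeg n (i + 1) v ∧ downMap n v = u)
    {u : Finset (Fin n) →₀ ZMod 2} (hu : u ∈ invariantsOn G Odd) (hDu : downMap n u = 0) :
    ∃ v ∈ invariantsOn G Even, downMap n v = u := by
  classical
  have hcomp (i : ℕ) : ∃ v ∈ invariantsOn G Even,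
      downMap n v = u.filter fun S => S.card = i := by
    rcases Nat.even_or_odd i with hi | hi
    · refine ⟨0, zero_mem _, ?_⟩
      ext S
      rw [map_zero, Finsupp.zero_apply, Finsupp.filter_apply]
      split_ifs with hS
      · exact (hu.2 S (by rw [hS]; exact Nat.not_odd_iff_even.2 hi)).symm
      · rfl
    · obtain ⟨v, hv, hv', hDv⟩ := h i hi (u.filter fun S => S.card = i)
        (isGInvariant_iff.2 fun g S => by simp [Finsupp.filter_apply, hu.1])
        (isHomogeneousDeg_iff.2 fun S hS => by
          by_contra hSi
          exact hS (Finsupp.filter_apply_neg _ _ hSi))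
        (by
          ext T
          rw [downMap_apply, Finsupp.zero_apply]
          have hT : ∀ j ∈ Tᶜ, (insert j T).card = T.card + 1 := fun j hj =>
            Finset.card_insert_of_notMem (Finset.mem_compl.1 hj)
          by_cases hi : T.card + 1 = i
          · have := DFunLike.congr_fun hDu T
            rw [downMap_apply, Finsupp.zero_apply] at this
            rw [← this]
            exact Finset.sum_congr rfl fun j hj =>
              Finsupp.filter_apply_pos _ _ ((hT j hj).trans hi)
          · exact Finset.sum_eq_zero fun j hj =>
              Finsupp.filter_apply_neg _ _ fun e => hi ((hT j hj).symm.trans e))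
      refine ⟨v, ⟨isGInvariant_iff.1 hv, fun S hS => ?_⟩, hDv⟩
      by_contra hvS
      exact hS (isHomogeneousDeg_iff.1 hv' S hvS ▸ hi.add_one)
  choose v hv hDv using hcomp
  refine ⟨∑ i ∈ Finset.range (n + 1), v i, sum_mem fun i _ => hv i, ?_⟩
  ext S
  have hS : S.card < n + 1 := Nat.lt_succ_of_le (by simpa using S.card_le_univ)
  simp only [map_sum, hDv, Finsupp.finsetSum_apply, Finsupp.filter_apply]
  rw [Finset.sum_ite_eq, if_pos (Finset.mem_range.2 hS)]

lemma image_ne_compl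
    (hnosc : ¬ ∃ S : Finset (Fin n), S.card = n / 2 ∧
      (fun T => (Finset.univ : Finset (Fin n)) \ T) '' orbit G S = orbit G S)
    {g : Equiv.Perm (Fin n)} (hg : g ∈ G) (S : Finset (Fin n)) : S.image g ≠ Sᶜ := by
  intro h
  have hcompl (k : G) (T : Finset (Fin n)) : (k • T)ᶜ = k • Tᶜ := by
    ext x
    simp [← Finset.inv_smul_mem_iff]
  have hgS : (⟨g, hg⟩ : G) • S = Sᶜ := h
  refine hnosc ⟨S, ?_, ?_⟩
  · have := congrArg Finset.card h
    rw [Finset.card_image_of_injective _ g.injective, Finset.card_compl, Fintype.card_fin] at this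
    have := S.card_le_univ
    rw [Fintype.card_fin] at this
    omega
  · simp only [← Finset.compl_eq_univ_sdiff]
    have hmem {T : Finset (Fin n)} (hT : T ∈ orbit G S) : Tᶜ ∈ orbit G S := by
      obtain ⟨k, rfl⟩ := hT
      exact ⟨k * ⟨g, hg⟩, by simp only [mul_smul, hgS, hcompl]⟩
    ext T
    exact ⟨fun ⟨U, hU, hT⟩ => hT ▸ hmem hU, fun hT => ⟨Tᶜ, hmem hT, compl_compl T⟩⟩

end DownMap

open DownMap in
/-- (Proposition 6.1.) If `n` is even and `G ≤ 𝔖_n` is transitive with no self-complementary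
orbit on `n/2`-element subsets, then the homology of `(C(𝔽₂)^G, D)` is not concentrated in even
dimensions: some odd-degree invariant cycle is not an invariant boundary. -/
theorem homology_not_concentrated_in_even_degrees (n : ℕ) (hn : 0 < n) (hev : Even n)
    (G : Subgroup (Equiv.Perm (Fin n)))
    (htrans : ∀ x y : Fin n, ∃ g ∈ G, g x = y)
    (hnosc : ¬ ∃ S : Finset (Fin n), S.card = n / 2 ∧
      (fun T => (Finset.univ : Finset (Fin n)) \ T) '' orbit G S = orbit G S) :
    ∃ i : ℕ, Odd i ∧ ∃ u : Finset (Fin n) →₀ ZMod 2,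
      IsGInvariant n G u ∧ IsHomogeneousDeg n i u ∧ downMap n u = 0 ∧
        ∀ v : Finset (Fin n) →₀ ZMod 2,
          IsGInvariant n G v → IsHomogeneousDeg n (i + 1) v → downMap n v ≠ u := by
  by_contra! hcon
  have hEO : ∀ u ∈ invariantsOn G Even, downMap n u ∈ invariantsOn G Odd :=
    fun u => downMap_mem_invariantsOn fun k hk => by grind
  have hOE : ∀ u ∈ invariantsOn G Odd, downMap n u ∈ invariantsOn G Even :=
    fun u => downMap_mem_invariantsOn fun k hk => by grind
  have hfinrank : Module.finrank (ZMod 2) (invariantsOn G Even) =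
      Module.finrank (ZMod 2) (invariantsOn G Odd) := by
    rw [finrank_invariantsOn, finrank_invariantsOn]
    exact card_orbits_even_eq_odd fun g hg => image_ne_compl hnosc hg
  have hexact := exact_of_exact_of_finrank_eq
    ((downMap n).restrict hEO) ((downMap n).restrict hOE) hfinrank
    (LinearMap.ext fun u => Subtype.ext (downMap_downMap u.1))
    (by
      apply le_antisymm
      · rintro ⟨u, hu⟩ hDu
        obtain ⟨v, hv, hDv⟩ :=
          exists_downMap_eq_of_homogeneous hcon hu (congrArg Subtype.val hDu)
        exact ⟨⟨v, hv⟩, Subtype.ext hDv⟩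
      · rintro _ ⟨v, rfl⟩
        exact Subtype.ext (downMap_downMap v.1))
  have he : Finsupp.single (∅ : Finset (Fin n)) (1 : ZMod 2) ∈ invariantsOn G Even := by
    refine ⟨fun g S => ?_, fun S hS => Finsupp.single_eq_of_ne ?_⟩
    · simp [Finsupp.single_apply, eq_comm (a := (∅ : Finset (Fin n)))]
    · rintro rfl
      simp at hS
  have hker : (⟨_, he⟩ : invariantsOn G Even) ∈ LinearMap.ker ((downMap n).restrict hEO) :=
    Subtype.ext (by simp [downMap])
  rw [hexact] at hker
  obtain ⟨v, hv⟩ := hker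
  have := DFunLike.congr_fun (congrArg Subtype.val hv) ∅
  rw [LinearMap.coe_restrict_apply,
    downMap_apply_empty hev htrans (isGInvariant_iff.2 v.2.1)] at this
  simp at this
end

section
/- Let k, ℓ be positive integers. The map M on P(k,ℓ) is a well-defined involution on its domain {λ : min(A(λ), B(λ)) < ∞}, pairing each λ in the domain with a partition obtained from λ by changing exactly one part by ±1, and M is acyclic: the directed graph on P(k,ℓ) having an edge μ → λ for every covering pair μ ⋖ λ with M(μ) = λ, and an edge λ → μ for every covering pair μ ⋖ λ such that {λ, μ} is not a matched pair, contains no directed cycle. -/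
/-- Partitions with `k` parts (zero parts allowed), each of size at most `ℓ`, encoded as
multisets of `k` values in `{0, …, ℓ}`. -/
def RectPartition (k ℓ : ℕ) : Set (Multiset ℕ) :=
  {m | Multiset.card m = k ∧ ∀ v ∈ m, v ≤ ℓ}

/-- The set of values eligible for `A(λ)`: nonzero values occurring among the parts of `λ`
having the same parity as `ℓ`. -/
def ASet (ℓ : ℕ) (m : Multiset ℕ) : Set ℕ :=
  {v | v ≠ 0 ∧ v % 2 = ℓ % 2 ∧ v ∈ m}

/-- The set of values eligible for `B(λ)`: values (zero allowed) occurring with odd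
multiplicity among the parts of `λ` and having parity opposite to `ℓ`. -/
def BSet (ℓ : ℕ) (m : Multiset ℕ) : Set ℕ :=
  {v | v % 2 ≠ ℓ % 2 ∧ Odd (m.count v)}

/-- `A(λ) ∈ ℕ∞`: the smallest element of `ASet`, or `∞` if none exists. -/
noncomputable def Aval (ℓ : ℕ) (m : Multiset ℕ) : ℕ∞ :=
  sInf ((↑) '' ASet ℓ m)

/-- `B(λ) ∈ ℕ∞`: the smallest element of `BSet`, or `∞` if none exists. -/
noncomputable def Bval (ℓ : ℕ) (m : Multiset ℕ) : ℕ∞ :=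
  sInf ((↑) '' BSet ℓ m)

/-- The domain of the matching: `min(A(λ), B(λ)) < ∞`. -/
def MatchDom (ℓ : ℕ) (m : Multiset ℕ) : Prop :=
  min (Aval ℓ m) (Bval ℓ m) < ⊤

/-- The Morse matching `M` on `P(k,ℓ)`: if `A(λ) < B(λ)`, replace one occurrence of `A(λ)`
by `A(λ) − 1`; if `B(λ) < A(λ)`, replace one occurrence of `B(λ)` by `B(λ) + 1`. -/
noncomputable def Mmatch (ℓ : ℕ) (m : Multiset ℕ) : Multiset ℕ :=
  if Aval ℓ m < Bval ℓ m then
    m.erase (sInf (ASet ℓ m)) + {sInf (ASet ℓ m) - 1}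
  else
    m.erase (sInf (BSet ℓ m)) + {sInf (BSet ℓ m) + 1}

/-- `μ ⋖ λ`: `μ` is obtained from `λ` by decreasing exactly one part by `1`. -/
def CovBy' (μ lam : Multiset ℕ) : Prop :=
  ∃ v ∈ lam, v ≠ 0 ∧ μ = lam.erase v + {v - 1}

/-- `{x, y}` is a matched pair of the matching `M`. -/
def IsMatchedPair (ℓ : ℕ) (x y : Multiset ℕ) : Prop :=
  (MatchDom ℓ x ∧ Mmatch ℓ x = y) ∨ (MatchDom ℓ y ∧ Mmatch ℓ y = x)

/-- `m` has a least element `a` of `ASet`, below every element of `BSet`: the matching lowers `a`. -/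
def IsLoweredAt (ℓ : ℕ) (m : Multiset ℕ) (a : ℕ) : Prop :=
  IsLeast (ASet ℓ m) a ∧ ∀ b ∈ BSet ℓ m, a < b

/-- `m` has a least element `b` of `BSet`, below every element of `ASet`: the matching raises `b`. -/
def IsRaisedAt (ℓ : ℕ) (m : Multiset ℕ) (b : ℕ) : Prop :=
  IsLeast (BSet ℓ m) b ∧ ∀ a ∈ ASet ℓ m, b < a

theorem sInf_image_natCast_lt_iff (S T : Set ℕ) :
    sInf (((↑) : ℕ → ℕ∞) '' S) < sInf ((↑) '' T) ↔ ∃ a, IsLeast S a ∧ ∀ b ∈ T, a < b := by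
  constructor
  · intro h
    obtain ⟨_, ⟨s, hs, rfl⟩, -⟩ := sInf_lt_iff.1 h
    have hleast : IsLeast S (sInf S) := ⟨Nat.sInf_mem ⟨s, hs⟩, fun _ hx => Nat.sInf_le hx⟩
    refine ⟨sInf S, hleast, fun b hb => ?_⟩
    have hle : ((sInf S : ℕ) : ℕ∞) ≤ sInf (((↑) : ℕ → ℕ∞) '' S) := by
      refine le_sInf ?_
      rintro _ ⟨x, hx, rfl⟩
      exact_mod_cast Nat.sInf_le hx
    exact_mod_cast (hle.trans_lt h).trans_le (sInf_le ⟨b, hb, rfl⟩)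
  · rintro ⟨a, ha, hab⟩
    have hle : sInf (((↑) : ℕ → ℕ∞) '' S) ≤ (a : ℕ∞) := sInf_le ⟨a, ha.1, rfl⟩
    have hsucc : ((a + 1 : ℕ) : ℕ∞) ≤ sInf (((↑) : ℕ → ℕ∞) '' T) := by
      refine le_sInf ?_
      rintro _ ⟨x, hx, rfl⟩
      exact_mod_cast hab x hx
    refine hle.trans_lt (lt_of_lt_of_le ?_ hsucc)
    exact_mod_cast Nat.lt_succ_self a

theorem Aval_lt_Bval_iff {ℓ : ℕ} {m : Multiset ℕ} :
    Aval ℓ m < Bval ℓ m ↔ ∃ a, IsLoweredAt ℓ m a :=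
  sInf_image_natCast_lt_iff _ _

theorem Bval_lt_Aval_iff {ℓ : ℕ} {m : Multiset ℕ} :
    Bval ℓ m < Aval ℓ m ↔ ∃ b, IsRaisedAt ℓ m b :=
  sInf_image_natCast_lt_iff _ _

theorem matchDom_iff {ℓ : ℕ} {m : Multiset ℕ} :
    MatchDom ℓ m ↔ (∃ a, IsLoweredAt ℓ m a) ∨ ∃ b, IsRaisedAt ℓ m b := by
  rw [← Aval_lt_Bval_iff, ← Bval_lt_Aval_iff, MatchDom]
  constructor
  · intro h
    refine lt_or_gt_of_ne fun heq => ?_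
    rw [← heq, min_self] at h
    obtain ⟨_, ⟨a, ha, rfl⟩, -⟩ := sInf_lt_iff.1 h
    have hA : Aval ℓ m ∈ ((↑) : ℕ → ℕ∞) '' ASet ℓ m := csInf_mem ⟨_, a, ha, rfl⟩
    have hB : Bval ℓ m ∈ ((↑) : ℕ → ℕ∞) '' BSet ℓ m := by
      refine csInf_mem (Set.nonempty_iff_ne_empty.2 fun hempty => ?_)
      rw [heq, Bval, hempty, sInf_empty] at h
      exact lt_irrefl _ h
    obtain ⟨x, hx, hxA⟩ := hA
    obtain ⟨y, hy, hyB⟩ := hB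
    have hxy : x = y := by exact_mod_cast hxA.trans (heq.trans hyB.symm)
    exact hy.1 (hxy ▸ hx.2.1)
  · rintro (h | h)
    · exact min_lt_of_left_lt (h.trans_le le_top)
    · exact min_lt_of_right_lt (h.trans_le le_top)

theorem IsLoweredAt.mmatch_eq {ℓ a : ℕ} {m : Multiset ℕ} (h : IsLoweredAt ℓ m a) :
    Mmatch ℓ m = m.erase a + {a - 1} := by
  rw [Mmatch, if_pos (Aval_lt_Bval_iff.2 ⟨a, h⟩), h.1.csInf_eq]

theorem IsRaisedAt.mmatch_eq {ℓ b : ℕ} {m : Multiset ℕ} (h : IsRaisedAt ℓ m b) :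
    Mmatch ℓ m = m.erase b + {b + 1} := by
  rw [Mmatch, if_neg (Bval_lt_Aval_iff.2 ⟨b, h⟩).not_gt, h.1.csInf_eq]

theorem Multiset.erase_cons_add_singleton (a b : ℕ) (t : Multiset ℕ) :
    (a ::ₘ t).erase a + {b} = b ::ₘ t := by
  rw [Multiset.erase_cons_head, add_comm, Multiset.singleton_add]

theorem mem_BSet_cons_of_ne {ℓ u v : ℕ} {t : Multiset ℕ} (h : u ≠ v) :
    u ∈ BSet ℓ (v ::ₘ t) ↔ u ∈ BSet ℓ t := by
  simp only [BSet, Set.mem_ofPred_eq, Multiset.count_cons_of_ne h]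

theorem mem_BSet_cons_self {ℓ v : ℕ} {t : Multiset ℕ} (h : v % 2 ≠ ℓ % 2) :
    v ∈ BSet ℓ (v ::ₘ t) ↔ v ∉ BSet ℓ t := by
  simp [BSet, h, Nat.odd_add_one]

theorem not_mem_BSet {ℓ v : ℕ} {t : Multiset ℕ} (h : v % 2 = ℓ % 2) : v ∉ BSet ℓ t :=
  fun hv => hv.1 h

theorem mem_ASet_cons {ℓ u v : ℕ} {t : Multiset ℕ} :
    u ∈ ASet ℓ (v ::ₘ t) ↔ (u = v ∧ v ≠ 0 ∧ v % 2 = ℓ % 2) ∨ u ∈ ASet ℓ t := by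
  simp only [ASet, Set.mem_ofPred_eq, Multiset.mem_cons]
  grind

theorem IsLoweredAt.isRaisedAt_pred {ℓ a : ℕ} {t : Multiset ℕ}
    (h : IsLoweredAt ℓ ((a + 1) ::ₘ t) (a + 1)) : IsRaisedAt ℓ (a ::ₘ t) a := by
  obtain ⟨⟨hmem, hleast⟩, hB⟩ := h
  have hpar : (a + 1) % 2 = ℓ % 2 := hmem.2.1
  have hpar' : a % 2 ≠ ℓ % 2 := by omega
  have key : ∀ u ∈ BSet ℓ t, a + 1 < u := fun u hu =>
    hB u ((mem_BSet_cons_of_ne fun h => not_mem_BSet (h ▸ hpar) hu).2 hu)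
  refine ⟨⟨(mem_BSet_cons_self hpar').2 fun hu => ?_, fun u hu => ?_⟩, fun u hu => ?_⟩
  · have := key a hu
    omega
  · by_cases hua : u = a
    · exact hua.ge
    · have := key u ((mem_BSet_cons_of_ne hua).1 hu)
      omega
  · rcases mem_ASet_cons.1 hu with ⟨-, -, h⟩ | h
    · exact absurd h hpar'
    · exact hleast (mem_ASet_cons.2 (Or.inr h))

theorem IsRaisedAt.isLoweredAt_succ {ℓ b : ℕ} {t : Multiset ℕ}
    (h : IsRaisedAt ℓ (b ::ₘ t) b) : IsLoweredAt ℓ ((b + 1) ::ₘ t) (b + 1) := by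
  obtain ⟨⟨hmem, hleast⟩, hA⟩ := h
  have hpar : b % 2 ≠ ℓ % 2 := hmem.1
  have hpar' : (b + 1) % 2 = ℓ % 2 := by omega
  refine ⟨⟨mem_ASet_cons.2 (Or.inl ⟨rfl, by omega, hpar'⟩), fun u hu => ?_⟩, fun u hu => ?_⟩
  · rcases mem_ASet_cons.1 hu with ⟨h, -, -⟩ | h
    · exact h.ge
    · exact hA u (mem_ASet_cons.2 (Or.inr h))
  · have hne : u ≠ b + 1 := fun h => not_mem_BSet (h ▸ hpar') hu
    have hut : u ∈ BSet ℓ t := (mem_BSet_cons_of_ne hne).1 hu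
    have hub : u ≠ b := fun h => (mem_BSet_cons_self hpar).1 hmem (h ▸ hut)
    have : b ≤ u := hleast ((mem_BSet_cons_of_ne hub).2 hut)
    omega

theorem IsLoweredAt.exists_cons {ℓ a : ℕ} {m : Multiset ℕ} (h : IsLoweredAt ℓ m a) :
    ∃ c t, a = c + 1 ∧ m = (c + 1) ::ₘ t ∧ Mmatch ℓ m = c ::ₘ t := by
  obtain ⟨c, rfl⟩ := Nat.exists_eq_succ_of_ne_zero h.1.1.1
  obtain ⟨t, rfl⟩ := Multiset.exists_cons_of_mem h.1.1.2.2
  exact ⟨c, t, rfl, rfl, by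
    rw [h.mmatch_eq, Multiset.erase_cons_add_singleton, Nat.succ_sub_one]⟩

theorem IsRaisedAt.exists_cons {ℓ b : ℕ} {m : Multiset ℕ} (h : IsRaisedAt ℓ m b) :
    ∃ t, m = b ::ₘ t ∧ Mmatch ℓ m = (b + 1) ::ₘ t := by
  obtain ⟨t, rfl⟩ := Multiset.exists_cons_of_mem (Multiset.count_pos.1 h.1.1.2.pos)
  exact ⟨t, rfl, by rw [h.mmatch_eq, Multiset.erase_cons_add_singleton]⟩

theorem covBy'_iff {x y : Multiset ℕ} :
    CovBy' x y ↔ ∃ c t, x = c ::ₘ t ∧ y = (c + 1) ::ₘ t := by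
  constructor
  · rintro ⟨v, hv, hv0, rfl⟩
    obtain ⟨c, rfl⟩ := Nat.exists_eq_succ_of_ne_zero hv0
    obtain ⟨t, rfl⟩ := Multiset.exists_cons_of_mem hv
    exact ⟨c, t, by rw [Multiset.erase_cons_add_singleton, Nat.succ_sub_one], rfl⟩
  · rintro ⟨c, t, rfl, rfl⟩
    exact ⟨c + 1, Multiset.mem_cons_self _ _, by omega, by
      rw [Multiset.erase_cons_add_singleton, Nat.add_sub_cancel]⟩

theorem mmatch_spec {k ℓ : ℕ} {m : Multiset ℕ} (hm : m ∈ RectPartition k ℓ)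
    (hdom : MatchDom ℓ m) :
    Mmatch ℓ m ∈ RectPartition k ℓ ∧ MatchDom ℓ (Mmatch ℓ m) ∧
      Mmatch ℓ (Mmatch ℓ m) = m ∧ (CovBy' (Mmatch ℓ m) m ∨ CovBy' m (Mmatch ℓ m)) := by
  obtain ⟨hcard, hle⟩ := hm
  rcases matchDom_iff.1 hdom with ⟨a, h⟩ | ⟨b, h⟩
  · obtain ⟨c, t, rfl, rfl, hM⟩ := h.exists_cons
    have hr := h.isRaisedAt_pred
    rw [hM]
    refine ⟨⟨by simpa using hcard, fun v hv => ?_⟩, matchDom_iff.2 (Or.inr ⟨c, hr⟩), ?_,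
      Or.inl (covBy'_iff.2 ⟨c, t, rfl, rfl⟩)⟩
    · rcases Multiset.mem_cons.1 hv with rfl | hv
      · have := hle _ (Multiset.mem_cons_self _ _)
        omega
      · exact hle v (Multiset.mem_cons_of_mem hv)
    · rw [hr.mmatch_eq, Multiset.erase_cons_add_singleton]
  · obtain ⟨t, rfl, hM⟩ := h.exists_cons
    have hl := h.isLoweredAt_succ
    rw [hM]
    refine ⟨⟨by simpa using hcard, fun v hv => ?_⟩, matchDom_iff.2 (Or.inl ⟨b + 1, hl⟩), ?_,
      Or.inr (covBy'_iff.2 ⟨b, t, rfl, rfl⟩)⟩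
    · rcases Multiset.mem_cons.1 hv with rfl | hv
      · have hb := hle _ (Multiset.mem_cons_self _ _)
        have hne : b ≠ ℓ := fun h' => h.1.1.1 (by rw [h'])
        omega
      · exact hle v (Multiset.mem_cons_of_mem hv)
    · rw [hl.mmatch_eq, Multiset.erase_cons_add_singleton, Nat.add_sub_cancel]

/-- Each `v` of parity opposite to `ℓ` is grouped with `v + 1`; `blockWeight` sums the indices of
the groups of the parts. -/
def blockWeight (ℓ : ℕ) (m : Multiset ℕ) : ℕ :=
  (m.map fun v => (v + ℓ + 1) / 2).sum

open Classical in
/-- A potential that strictly decreases along every edge of the directed graph of the matching. -/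
noncomputable def matchPotential (ℓ : ℕ) (m : Multiset ℕ) : ℕ ×ₗ ℕ ×ₗ ℕ :=
  toLex (blockWeight ℓ m, toLex (if ∃ a, IsLoweredAt ℓ m a then 0 else 1, m.sum))

theorem blockWeight_cons (ℓ v : ℕ) (t : Multiset ℕ) :
    blockWeight ℓ (v ::ₘ t) = (v + ℓ + 1) / 2 + blockWeight ℓ t := by
  simp [blockWeight]

/-- Lowering a part of the parity of `ℓ`, other than the one lowered by the matching, does not
change which part the matching lowers. -/
theorem IsLoweredAt.of_cons_succ {ℓ a c : ℕ} {t : Multiset ℕ}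
    (h : IsLoweredAt ℓ ((c + 1) ::ₘ t) a) (hpar : (c + 1) % 2 = ℓ % 2) (hne : a ≠ c + 1) :
    IsLoweredAt ℓ (c ::ₘ t) a := by
  obtain ⟨⟨hmem, hleast⟩, hB⟩ := h
  have hac : a ≤ c + 1 := hleast (mem_ASet_cons.2 (Or.inl ⟨rfl, by omega, hpar⟩))
  have hapar : a % 2 = ℓ % 2 := hmem.2.1
  refine ⟨⟨mem_ASet_cons.2 (Or.inr ?_), fun u hu => ?_⟩, fun u hu => ?_⟩
  · exact (mem_ASet_cons.1 hmem).resolve_left fun h => hne h.1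
  · rcases mem_ASet_cons.1 hu with ⟨-, -, h⟩ | h
    · omega
    · exact hleast (mem_ASet_cons.2 (Or.inr h))
  · by_cases huc : u = c
    · omega
    · have hut := (mem_BSet_cons_of_ne huc).1 hu
      exact hB u ((mem_BSet_cons_of_ne fun h => not_mem_BSet (h ▸ hpar) hut).2 hut)

theorem matchPotential_mmatch_lt {ℓ : ℕ} {x y : Multiset ℕ} (hcov : CovBy' x y)
    (hdom : MatchDom ℓ x) (hM : Mmatch ℓ x = y) : matchPotential ℓ y < matchPotential ℓ x := by
  have hnot : ¬ ∃ a, IsLoweredAt ℓ x a := by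
    rintro ⟨a, h⟩
    obtain ⟨c, t, rfl, rfl, hM'⟩ := h.exists_cons
    obtain ⟨d, s, hx, hy⟩ := covBy'_iff.1 hcov
    have h1 := congrArg Multiset.sum hx
    have h2 := congrArg Multiset.sum (hM'.symm.trans (hM.trans hy))
    simp only [Multiset.sum_cons] at h1 h2
    omega
  obtain ⟨b, h⟩ := (matchDom_iff.1 hdom).resolve_left hnot
  obtain ⟨t, rfl, hM'⟩ := h.exists_cons
  obtain rfl := hM'.symm.trans hM
  have hpar : b % 2 ≠ ℓ % 2 := h.1.1.1
  rw [matchPotential, matchPotential, if_neg hnot, if_pos ⟨_, h.isLoweredAt_succ⟩,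
    Prod.Lex.toLex_lt_toLex]
  refine Or.inr ⟨?_, Prod.Lex.toLex_lt_toLex.2 (Or.inl zero_lt_one)⟩
  simp only [blockWeight_cons]
  omega

theorem matchPotential_lt_of_not_isMatchedPair {ℓ : ℕ} {x y : Multiset ℕ} (hcov : CovBy' y x)
    (hM : ¬ IsMatchedPair ℓ x y) : matchPotential ℓ y < matchPotential ℓ x := by
  obtain ⟨c, t, rfl, rfl⟩ := covBy'_iff.1 hcov
  rw [matchPotential, matchPotential, Prod.Lex.toLex_lt_toLex]
  simp only [blockWeight_cons]
  by_cases hpar : (c + 1) % 2 = ℓ % 2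
  · refine Or.inr ⟨by omega, ?_⟩
    have hsum : (c ::ₘ t).sum < ((c + 1) ::ₘ t).sum := by
      simp only [Multiset.sum_cons]
      omega
    rw [Prod.Lex.toLex_lt_toLex]
    by_cases htop : ∃ a, IsLoweredAt ℓ ((c + 1) ::ₘ t) a
    · obtain ⟨a, h⟩ := htop
      have hne : a ≠ c + 1 := by
        rintro rfl
        refine hM (Or.inl ⟨matchDom_iff.2 (Or.inl ⟨_, h⟩), ?_⟩)
        rw [h.mmatch_eq, Multiset.erase_cons_add_singleton, Nat.add_sub_cancel]
      rw [if_pos ⟨a, h.of_cons_succ hpar hne⟩, if_pos ⟨a, h⟩]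
      exact Or.inr ⟨rfl, hsum⟩
    · rw [if_neg htop]
      split_ifs
      · exact Or.inl zero_lt_one
      · exact Or.inr ⟨rfl, hsum⟩
  · left
    omega

/-- (Part of Theorem 4.4.) The map `M` is a well-defined involution on its domain, pairing each
partition in the domain with a partition obtained from it by changing exactly one part by `±1`,
and the matching `M` is acyclic: the associated directed graph (upward matched edges, downward
unmatched covering edges) on `P(k,ℓ)` has no directed cycle. -/
theorem rectangle_matching_involution_and_acyclic (k ℓ : ℕ) (hk : 0 < k) (hℓ : 0 < ℓ) :
    (∀ m ∈ RectPartition k ℓ, MatchDom ℓ m →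
        Mmatch ℓ m ∈ RectPartition k ℓ ∧ MatchDom ℓ (Mmatch ℓ m) ∧
        Mmatch ℓ (Mmatch ℓ m) = m ∧
        (CovBy' (Mmatch ℓ m) m ∨ CovBy' m (Mmatch ℓ m))) ∧
    (∀ m : Multiset ℕ, ¬ Relation.TransGen
        (fun x y : Multiset ℕ =>
          x ∈ RectPartition k ℓ ∧ y ∈ RectPartition k ℓ ∧
            ((CovBy' x y ∧ MatchDom ℓ x ∧ Mmatch ℓ x = y) ∨
             (CovBy' y x ∧ ¬ IsMatchedPair ℓ x y)))
        m m) := by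
  refine ⟨fun m hm hdom => mmatch_spec hm hdom, fun m hcycle => ?_⟩
  refine lt_irrefl (matchPotential ℓ m) (Relation.TransGen.trans_induction_on
    (motive := fun {x y} _ => matchPotential ℓ y < matchPotential ℓ x) hcycle ?_
    fun _ _ h₁ h₂ => h₂.trans h₁)
  rintro x y ⟨-, -, ⟨hcov, hdom, hM⟩ | ⟨hcov, hM⟩⟩
  · exact matchPotential_mmatch_lt hcov hdom hM
  · exact matchPotential_lt_of_not_isMatchedPair hcov hM
end

section
/- Let k, ℓ be positive integers. The number of partitions λ ∈ P(k,ℓ) such that every nonzero value occurring among the parts of λ occurs an even number of times and has parity opposite to that of ℓ, and such that, if ℓ is odd, the value 0 occurs an even number of times among λ_1, …, λ_k, equals the number of self-complementary partitions in P(k,ℓ). -/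
/-- In an antitone sequence in which every value `≥ v` has even multiplicity, every entry `≥ v` at
an even position is followed by an equal entry. -/
theorem exists_succ_eq_of_even_card_fibers {k : ℕ} {lam : Fin k → ℕ} (hanti : Antitone lam)
    {i : Fin k} (hi : Even (i : ℕ))
    (hev : ∀ v, lam i ≤ v → Even (Finset.univ.filter fun j => lam j = v).card) :
    ∃ h : (i : ℕ) + 1 < k, lam ⟨i + 1, h⟩ = lam i := by
  by_contra hcon
  have hset : (Finset.univ.filter fun j => lam i ≤ lam j) = Finset.Iic i := by
    ext j
    simp only [Finset.mem_filter, Finset.mem_univ, true_and, Finset.mem_Iic]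
    refine ⟨fun hj => ?_, fun hj => hanti hj⟩
    by_contra hlt
    rw [not_le, Fin.lt_def] at hlt
    have hk : (i : ℕ) + 1 < k := by omega
    refine hcon ⟨hk, le_antisymm (hanti ?_) (hj.trans (hanti ?_))⟩ <;> rw [Fin.le_def]
    · exact Nat.le_succ _
    · exact hlt
  have hcard : Even (Finset.univ.filter fun j => lam i ≤ lam j).card := by
    rw [Finset.card_eq_sum_card_image lam]
    refine Finset.even_sum _ fun v hv => ?_
    obtain ⟨j, hj, rfl⟩ := Finset.mem_image.1 hv
    have hij := (Finset.mem_filter.1 hj).2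
    rw [Finset.filter_filter, Finset.filter_congr (q := fun x => lam x = lam j)
      fun x _ => ⟨fun h => h.2, fun h => ⟨h ▸ hij, h⟩⟩]
    exact hev _ hij
  rw [hset, Fin.card_Iic] at hcard
  exact (Nat.not_even_iff_odd.2 hi.add_one) hcard

/-- If positions `2m` and `2m + 1` carry equal entries whenever one of them carries `v`, then the
multiplicity of `v` is even. -/
theorem even_card_fiber_of_pairs {k : ℕ} {lam : Fin k → ℕ} (hanti : Antitone lam) {v : ℕ}
    (h : ∀ i : Fin k, Even (i : ℕ) → v ≤ lam i →
      ∃ h : (i : ℕ) + 1 < k, lam ⟨i + 1, h⟩ = lam i) :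
    Even (Finset.univ.filter fun j => lam j = v).card := by
  have hs : ∑ _j ∈ Finset.univ.filter (fun j => lam j = v), (1 : ZMod 2) = 0 := by
    refine Finset.sum_involution
      (fun i hi => if hp : Even (i : ℕ) then
          ⟨i + 1, (h i hp (Finset.mem_filter.1 hi).2.ge).1⟩
        else ⟨i - 1, by omega⟩) ?_ ?_ ?_ ?_
    · intros; decide
    · intro i hi _ heq
      split_ifs at heq with hp <;> rw [Fin.ext_iff] at heq <;> simp only at heq
      · omega
      · rw [Nat.not_even_iff] at hp
        omega
    · intro i hi
      have hv := (Finset.mem_filter.1 hi).2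
      split_ifs with hp
      · simpa [(h i hp hv.ge).2] using hv
      · rw [Nat.not_even_iff] at hp
        have hle : v ≤ lam ⟨i - 1, by omega⟩ := by
          rw [← hv]
          exact hanti (Fin.le_def.2 (Nat.sub_le _ _))
        obtain ⟨hlt, he⟩ := h ⟨i - 1, by omega⟩ (by rw [Nat.even_iff]; simp only; omega) hle
        have hi' : (⟨(i : ℕ) - 1 + 1, hlt⟩ : Fin k) = i := by
          ext
          simp only
          omega
        simp only [hi'] at he
        simp [← he, hv]
    · intro i hi
      ext
      by_cases hp : Even (i : ℕ)
      · have : ¬ Even ((i : ℕ) + 1) := Nat.not_even_iff_odd.2 hp.add_one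
        simp [hp, this]
      · have hp' := Nat.not_even_iff.1 hp
        have : Even ((i : ℕ) - 1) := by rw [Nat.even_iff]; omega
        simp [hp, this]
        omega
  rw [Finset.sum_const, nsmul_eq_mul, mul_one] at hs
  exact (ZMod.natCast_eq_zero_iff_even).1 hs

/-- Among the partitions in a `k × ℓ` rectangle, those with evenly repeated nonzero values of parity
opposite to `ℓ` (and, for odd `ℓ`, evenly many zeros) are those that decompose into pairs of
consecutive equal parts, up to a tail of zeros. -/
theorem even_multiplicities_iff_pairs {k ℓ : ℕ} {lam : Fin k → ℕ} (hanti : Antitone lam) :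
    ((∀ v : ℕ, v ≠ 0 → (∃ i : Fin k, lam i = v) →
        Even (Finset.univ.filter fun i : Fin k => lam i = v).card ∧ v % 2 ≠ ℓ % 2) ∧
      (ℓ % 2 = 1 → Even (Finset.univ.filter fun i : Fin k => lam i = 0).card)) ↔
    (∀ i, lam i ≠ 0 → lam i % 2 ≠ ℓ % 2) ∧
      ∀ i : Fin k, Even (i : ℕ) → (lam i ≠ 0 ∨ ℓ % 2 = 1) →
        ∃ h : (i : ℕ) + 1 < k, lam ⟨i + 1, h⟩ = lam i := by
  constructor
  · rintro ⟨hpos, hzero⟩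
    refine ⟨fun i hi => (hpos _ hi ⟨i, rfl⟩).2, fun i hi hor => ?_⟩
    refine exists_succ_eq_of_even_card_fibers hanti hi fun v hv => ?_
    by_cases hv0 : v = 0
    · subst hv0
      exact hzero (by omega)
    · by_cases hex : ∃ j, lam j = v
      · exact (hpos v hv0 hex).1
      · rw [Finset.filter_eq_empty_iff.2 fun j _ hj => hex ⟨j, hj⟩]
        simp
  · rintro ⟨hpar, hpair⟩
    refine ⟨fun v hv => ?_, fun hl => ?_⟩
    · rintro ⟨i, rfl⟩
      exact ⟨even_card_fiber_of_pairs hanti fun j hj hle => hpair j hj (by omega), hpar i hv⟩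
    · exact even_card_fiber_of_pairs hanti fun j hj _ => hpair j hj (Or.inr hl)

/-- Keep one part of each pair, halve it and place it above the middle line of the rectangle; the
remaining parts are the complements. -/
def selfComplementaryOfPairs {k : ℕ} (ℓ : ℕ) (lam : Fin k → ℕ) (i : Fin k) : ℕ :=
  if _ : 2 * (i : ℕ) + 1 < k then (ℓ + 1) / 2 + (lam ⟨2 * i, by omega⟩ + 1) / 2
  else if _ : 2 * (i : ℕ) + 1 = k then ℓ / 2
  else ℓ / 2 - (lam ⟨2 * (k - 1 - i), by omega⟩ + 1) / 2

/-- Double the excess over the middle line of each part in the upper half, and repeat it twice. -/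
def pairsOfSelfComplementary {k : ℕ} (ℓ : ℕ) (lam : Fin k → ℕ) (i : Fin k) : ℕ :=
  if 2 * ((i : ℕ) / 2) + 1 < k then
    2 * (lam ⟨i / 2, by omega⟩ - (ℓ + 1) / 2) - (1 - ℓ % 2)
  else 0

section Bijection

variable {k ℓ : ℕ} {lam : Fin k → ℕ}

theorem half_le_of_self_complementary (hanti : Antitone lam) (hsc : ∀ i, lam i + lam i.rev = ℓ)
    {i : Fin k} (hi : 2 * (i : ℕ) + 1 ≤ k) : (ℓ + 1) / 2 ≤ lam i := by
  have hle : lam i.rev ≤ lam i := hanti (by rw [Fin.le_def, Fin.val_rev]; omega)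
  have := hsc i
  omega

theorem succ_half_le_of_parity (hle : ∀ i, lam i ≤ ℓ)
    (hpar : ∀ i, lam i ≠ 0 → lam i % 2 ≠ ℓ % 2) (i : Fin k) : (lam i + 1) / 2 ≤ ℓ / 2 := by
  have := hle i
  have := hpar i
  omega

theorem even_of_two_mul_add_one_eq
    (hpair : ∀ i : Fin k, Even (i : ℕ) → (lam i ≠ 0 ∨ ℓ % 2 = 1) →
      ∃ h : (i : ℕ) + 1 < k, lam ⟨i + 1, h⟩ = lam i) {m : ℕ} (hm : 2 * m + 1 = k) :
    ℓ % 2 = 0 := by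
  by_contra hl
  obtain ⟨h, -⟩ := hpair ⟨2 * m, by omega⟩ (even_two_mul m) (Or.inr (by omega))
  simp only at h
  omega

theorem selfComplementaryOfPairs_antitone (hanti : Antitone lam) :
    Antitone (selfComplementaryOfPairs ℓ lam) := by
  intro i j hij
  rw [Fin.le_def] at hij
  have hmono : ∀ a b (ha : a < k) (hb : b < k), a ≤ b → lam ⟨b, hb⟩ ≤ lam ⟨a, ha⟩ :=
    fun a b ha hb h => hanti (Fin.le_def.2 h)
  unfold selfComplementaryOfPairs
  split_ifs with h₁ h₂ h₃ h₄ h₅ h₆ <;> try omega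
  · have := hmono (2 * i) (2 * j) (by omega) (by omega) (by omega)
    omega
  · have := hmono (2 * (k - 1 - j)) (2 * (k - 1 - i)) (by omega) (by omega) (by omega)
    omega

theorem selfComplementaryOfPairs_add_rev (hle : ∀ i, lam i ≤ ℓ)
    (hpar : ∀ i, lam i ≠ 0 → lam i % 2 ≠ ℓ % 2)
    (hpair : ∀ i : Fin k, Even (i : ℕ) → (lam i ≠ 0 ∨ ℓ % 2 = 1) →
      ∃ h : (i : ℕ) + 1 < k, lam ⟨i + 1, h⟩ = lam i) (i : Fin k) :
    selfComplementaryOfPairs ℓ lam i + selfComplementaryOfPairs ℓ lam i.rev = ℓ := by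
  have hrev := Fin.val_rev i
  have hhalf := succ_half_le_of_parity hle hpar
  unfold selfComplementaryOfPairs
  split_ifs with h₁ h₂ h₃ h₄ h₅ h₆ <;> try omega
  · have hidx : k - 1 - (i.rev : ℕ) = i := by omega
    simp only [hidx]
    have := hhalf ⟨2 * i, by omega⟩
    omega
  · have := even_of_two_mul_add_one_eq hpair h₄
    omega
  · have hidx : k - 1 - (i : ℕ) = i.rev := by omega
    simp only [hidx]
    have := hhalf ⟨2 * i.rev, by omega⟩
    omega

theorem pairsOfSelfComplementary_antitone (hanti : Antitone lam) :
    Antitone (pairsOfSelfComplementary ℓ lam) := by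
  intro i j hij
  rw [Fin.le_def] at hij
  unfold pairsOfSelfComplementary
  split_ifs <;> try omega
  have : lam ⟨j / 2, by omega⟩ ≤ lam ⟨i / 2, by omega⟩ :=
    hanti (Fin.le_def.2 (Nat.div_le_div_right hij))
  omega

theorem pairsOfSelfComplementary_le (hle : ∀ i, lam i ≤ ℓ) (i : Fin k) :
    pairsOfSelfComplementary ℓ lam i ≤ ℓ := by
  unfold pairsOfSelfComplementary
  have := hle ⟨i / 2, by omega⟩
  split_ifs <;> omega

theorem pairsOfSelfComplementary_parity (i : Fin k) (hi : pairsOfSelfComplementary ℓ lam i ≠ 0) :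
    pairsOfSelfComplementary ℓ lam i % 2 ≠ ℓ % 2 := by
  unfold pairsOfSelfComplementary at hi ⊢
  split_ifs at hi ⊢ <;> omega

theorem pairsOfSelfComplementary_pairs (hsc : ∀ i, lam i + lam i.rev = ℓ)
    (i : Fin k) (hi : Even (i : ℕ))
    (hor : pairsOfSelfComplementary ℓ lam i ≠ 0 ∨ ℓ % 2 = 1) :
    ∃ h : (i : ℕ) + 1 < k,
      pairsOfSelfComplementary ℓ lam ⟨i + 1, h⟩ = pairsOfSelfComplementary ℓ lam i := by
  rw [Nat.even_iff] at hi
  have hlt : (i : ℕ) + 1 < k := by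
    by_contra hk
    rcases hor with hne | hl
    · refine hne (if_neg ?_)
      omega
    · have hmid := hsc ⟨i / 2, by omega⟩
      have hfix : (⟨(i : ℕ) / 2, by omega⟩ : Fin k).rev = ⟨i / 2, by omega⟩ := by
        ext
        simp only [Fin.val_rev]
        omega
      rw [hfix] at hmid
      omega
  refine ⟨hlt, ?_⟩
  have hidx : ((i : ℕ) + 1) / 2 = i / 2 := by omega
  simp only [pairsOfSelfComplementary, hidx]

theorem pairsOfSelfComplementary_selfComplementaryOfPairs
    (hpar : ∀ i, lam i ≠ 0 → lam i % 2 ≠ ℓ % 2)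
    (hpair : ∀ i : Fin k, Even (i : ℕ) → (lam i ≠ 0 ∨ ℓ % 2 = 1) →
      ∃ h : (i : ℕ) + 1 < k, lam ⟨i + 1, h⟩ = lam i) (hanti : Antitone lam) :
    pairsOfSelfComplementary ℓ (selfComplementaryOfPairs ℓ lam) = lam := by
  funext i
  unfold pairsOfSelfComplementary
  split_ifs with hi
  · have hfst : lam ⟨2 * (i / 2), by omega⟩ = lam i := by
      have hor : 2 * ((i : ℕ) / 2) = i ∨ 2 * ((i : ℕ) / 2) + 1 = i := by omega
      rcases hor with h | h
      · simp only [h]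
      · by_cases h0 : lam ⟨2 * (i / 2), by omega⟩ = 0
        · have : lam i ≤ lam ⟨2 * (i / 2), by omega⟩ :=
            hanti (by rw [Fin.le_def]; simp only; omega)
          omega
        · obtain ⟨_, he⟩ := hpair ⟨2 * (i / 2), by omega⟩ (even_two_mul _) (Or.inl h0)
          simp only [h] at he
          exact he.symm
    have := hpar i
    simp only [selfComplementaryOfPairs, dif_pos hi, hfst]
    omega
  · by_contra hne
    obtain ⟨h, -⟩ := hpair i (by rw [Nat.even_iff]; omega) (Or.inl (Ne.symm hne))
    omega

theorem selfComplementaryOfPairs_pairsOfSelfComplementary (hanti : Antitone lam)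
    (hsc : ∀ i, lam i + lam i.rev = ℓ) :
    selfComplementaryOfPairs ℓ (pairsOfSelfComplementary ℓ lam) = lam := by
  funext i
  have hi := hsc i
  have hrev := Fin.val_rev i
  unfold selfComplementaryOfPairs
  split_ifs with h₁ h₂
  · have := half_le_of_self_complementary hanti hsc h₁.le
    have hidx : 2 * (i : ℕ) / 2 = i := by omega
    simp only [pairsOfSelfComplementary, hidx, if_pos h₁, Fin.eta]
    omega
  · have hfix : i.rev = i := by
      ext
      omega
    rw [hfix] at hi
    omega
  · have hlt : 2 * (i.rev : ℕ) + 1 < k := by omega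
    have := half_le_of_self_complementary hanti hsc hlt.le
    have hidx : k - 1 - (i : ℕ) = i.rev := by omega
    have hidx' : 2 * (i.rev : ℕ) / 2 = i.rev := by omega
    simp only [pairsOfSelfComplementary, hidx, hidx', if_pos hlt, Fin.eta]
    omega

end Bijection


/-- (Proposition 4.3 + Theorem 4.5.) The number of partitions in a `k × ℓ` rectangle all of
whose nonzero values have even multiplicity and parity opposite to `ℓ` (with, when `ℓ` is odd,
evenly many zero parts) equals the number of self-complementary partitions in the rectangle. -/
theorem critical_cells_equinumerous_with_self_complementary (k ℓ : ℕ)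
    (hk : 0 < k) (hℓ : 0 < ℓ) :
    Nat.card {lam : Fin k → ℕ //
        (∀ i j : Fin k, i ≤ j → lam j ≤ lam i) ∧ (∀ i : Fin k, lam i ≤ ℓ) ∧
        (∀ v : ℕ, v ≠ 0 → (∃ i : Fin k, lam i = v) →
          Even (Finset.univ.filter fun i : Fin k => lam i = v).card ∧ v % 2 ≠ ℓ % 2) ∧
        (ℓ % 2 = 1 → Even (Finset.univ.filter fun i : Fin k => lam i = 0).card)} =
      Nat.card {lam : Fin k → ℕ //
        (∀ i j : Fin k, i ≤ j → lam j ≤ lam i) ∧ (∀ i : Fin k, lam i ≤ ℓ) ∧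
        ∀ i : Fin k, lam i + lam i.rev = ℓ} := by
  refine Nat.card_congr
    { toFun := fun x => ⟨selfComplementaryOfPairs ℓ x.1, ?_⟩
      invFun := fun y => ⟨pairsOfSelfComplementary ℓ y.1, ?_⟩
      left_inv := ?_
      right_inv := ?_ }
  · obtain ⟨lam, hanti, hle, hmult⟩ := x
    obtain ⟨hpar, hpair⟩ := (even_multiplicities_iff_pairs hanti).1 hmult
    have hsum := selfComplementaryOfPairs_add_rev hle hpar hpair
    exact ⟨selfComplementaryOfPairs_antitone hanti,
      fun i => (Nat.le_add_right _ _).trans_eq (hsum i), hsum⟩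
  · obtain ⟨lam, hanti, hle, hsc⟩ := y
    have hanti' := pairsOfSelfComplementary_antitone (ℓ := ℓ) hanti
    exact ⟨hanti', pairsOfSelfComplementary_le hle, (even_multiplicities_iff_pairs hanti').2
      ⟨pairsOfSelfComplementary_parity, pairsOfSelfComplementary_pairs hsc⟩⟩
  · rintro ⟨lam, hanti, hle, hmult⟩
    obtain ⟨hpar, hpair⟩ := (even_multiplicities_iff_pairs hanti).1 hmult
    exact Subtype.ext (pairsOfSelfComplementary_selfComplementaryOfPairs hpar hpair hanti)
  · rintro ⟨lam, hanti, hle, hsc⟩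
    exact Subtype.ext (selfComplementaryOfPairs_pairsOfSelfComplementary hanti hsc)
end

section
/- Let k, ℓ be positive integers. Then ∑_{λ ∈ P(k,ℓ)} (−1)^{λ_1 + λ_2 + ⋯ + λ_k} equals the number of self-complementary partitions in P(k,ℓ). (This is the q = −1 evaluation of the Gaussian binomial coefficient [k+ℓ choose k]_q, realized as the Euler characteristic of a chain complex.) -/
/-- The partitions with `k` parts (some possibly zero), each of size at most `ℓ`. -/
def rectPartitions (k ℓ : ℕ) : Finset (Fin k → ℕ) :=
  (Fintype.piFinset fun _ => Finset.range (ℓ + 1)).filter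
    fun lam => ∀ i j : Fin k, i ≤ j → lam j ≤ lam i

lemma mem_rectPartitions {k ℓ : ℕ} {lam : Fin k → ℕ} :
    lam ∈ rectPartitions k ℓ ↔
      (∀ i, lam i ≤ ℓ) ∧ ∀ i j : Fin k, i ≤ j → lam j ≤ lam i := by
  simp [rectPartitions]

lemma rectPartitions_succ_succ (k ℓ : ℕ) :
    rectPartitions (k + 1) (ℓ + 1) =
      (rectPartitions k (ℓ + 1)).image (fun lam => (Fin.snoc lam 0 : Fin (k + 1) → ℕ)) ∪
        (rectPartitions (k + 1) ℓ).image (fun lam i => lam i + 1) := by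
  ext lam
  simp only [Finset.mem_union, Finset.mem_image, mem_rectPartitions]
  constructor
  · rintro ⟨hle, hanti⟩
    by_cases h0 : lam (Fin.last k) = 0
    · refine Or.inl ⟨fun i => lam i.castSucc, ⟨fun i => hle _, fun i j hij => hanti _ _ ?_⟩, ?_⟩
      · simpa using hij
      · rw [← h0]
        exact Fin.snoc_init_self lam
    · have hpos : ∀ i, lam i - 1 + 1 = lam i := fun i => by
        have := hanti i (Fin.last k) (Fin.le_last i)
        omega
      refine Or.inr ⟨fun i => lam i - 1, ⟨fun i => ?_, fun i j hij => ?_⟩, funext hpos⟩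
      · have := hle i
        have := hpos i
        dsimp only
        omega
      · exact Nat.sub_le_sub_right (hanti i j hij) 1
  · rintro (⟨mu, ⟨hle, hanti⟩, rfl⟩ | ⟨mu, ⟨hle, hanti⟩, rfl⟩)
    · refine ⟨fun i => ?_, fun i j => ?_⟩
      · induction i using Fin.lastCases <;> simp [hle]
      · induction j using Fin.lastCases with
        | last => simp
        | cast j =>
          induction i using Fin.lastCases with
          | last => intro h; exact absurd h (by simp)
          | cast i => simpa using hanti i j
    · exact ⟨fun i => by simpa using hle i, fun i j hij => by simpa using hanti i j hij⟩

/-- The `q`-Pascal recursion for the generating function of partitions in a rectangle. -/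
lemma sum_rectPartitions_succ_succ (q : ℤ) (k ℓ : ℕ) :
    ∑ lam ∈ rectPartitions (k + 1) (ℓ + 1), q ^ (∑ i, lam i) =
      ∑ lam ∈ rectPartitions k (ℓ + 1), q ^ (∑ i, lam i) +
        q ^ (k + 1) * ∑ lam ∈ rectPartitions (k + 1) ℓ, q ^ (∑ i, lam i) := by
  rw [rectPartitions_succ_succ, Finset.sum_union, Finset.sum_image, Finset.sum_image,
    Finset.mul_sum]
  · congr 1
    · exact Finset.sum_congr rfl fun lam _ => by simp [Fin.sum_univ_castSucc]
    · exact Finset.sum_congr rfl fun lam _ => by simp [Finset.sum_add_distrib, pow_add]; ring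
  · exact fun a _ b _ h => funext fun i => by simpa using congrFun h i
  · exact fun a _ b _ h => funext fun i => by simpa using congrFun h i.castSucc
  · rw [Finset.disjoint_left]
    simp only [Finset.mem_image, not_exists, not_and]
    rintro _ ⟨a, _, rfl⟩ b _ h
    simpa using congrFun h (Fin.last k)

lemma rectPartitions_zero_left (ℓ : ℕ) : rectPartitions 0 ℓ = {Fin.elim0} := by
  ext lam
  simp [mem_rectPartitions, eq_iff_true_of_subsingleton]

lemma rectPartitions_zero_right (k : ℕ) : rectPartitions k 0 = {0} := by
  ext lam
  simp only [mem_rectPartitions, Finset.mem_singleton, funext_iff, Pi.zero_apply,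
    Nat.le_zero]
  exact ⟨fun h => h.1, fun h => ⟨h, fun i j _ => by simp [h]⟩⟩

lemma card_rectPartitions (k ℓ : ℕ) : (rectPartitions k ℓ).card = (k + ℓ).choose k := by
  induction k generalizing ℓ with
  | zero => simp [rectPartitions_zero_left]
  | succ k ihk =>
    induction ℓ with
    | zero => simp [rectPartitions_zero_right]
    | succ ℓ ihl =>
      have h := sum_rectPartitions_succ_succ 1 k ℓ
      simp only [one_pow, Finset.sum_const, nsmul_eq_mul, mul_one, one_mul] at h
      rw [ihk, ihl] at h
      rw [← add_assoc, Nat.choose_succ_succ, add_right_comm k 1 ℓ, add_assoc k ℓ 1]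
      rw [add_right_comm k 1 ℓ, add_assoc k ℓ 1] at h
      exact_mod_cast h

lemma sum_neg_one_pow_rectPartitions (k ℓ : ℕ) :
    ∑ lam ∈ rectPartitions k ℓ, (-1 : ℤ) ^ (∑ i, lam i) =
      if Odd k ∧ Odd ℓ then 0 else ((k / 2 + ℓ / 2).choose (k / 2) : ℤ) := by
  induction k generalizing ℓ with
  | zero => simp [rectPartitions_zero_left]
  | succ k ihk =>
    induction ℓ with
    | zero => simp [rectPartitions_zero_right]
    | succ ℓ ihl =>
      rw [sum_rectPartitions_succ_succ, ihk, ihl]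
      obtain ⟨a, rfl | rfl⟩ := Nat.even_or_odd' k <;>
        obtain ⟨b, rfl | rfl⟩ := Nat.even_or_odd' ℓ
      all_goals
        have hdiv : ∀ n, (2 * n + 1) / 2 = n ∧ (2 * n + 1 + 1) / 2 = n + 1 := by omega
        simp only [Nat.odd_iff, hdiv, Nat.mul_div_cancel_left _ two_pos]
      · simp [pow_succ]
      · simp [Nat.add_mod]
      · simp [Nat.add_mod, pow_succ]
      · have hpascal : (a + 1 + (b + 1)).choose (a + 1) =
            (a + (b + 1)).choose a + (a + 1 + b).choose (a + 1) := by
          rw [show a + 1 + (b + 1) = a + (b + 1) + 1 by ring, Nat.choose_succ_succ,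
            show a + 1 + b = a + (b + 1) by ring]
        simp [Nat.add_mod, pow_succ, hpascal]

/-- The partitions in the `k × ℓ` rectangle equal to their complement in it. -/
def selfComplementary (k ℓ : ℕ) : Finset (Fin k → ℕ) :=
  (rectPartitions k ℓ).filter fun lam => ∀ i, lam i + lam i.rev = ℓ

lemma selfComplementary_eq_empty {k ℓ : ℕ} (hk : Odd k) (hℓ : Odd ℓ) :
    selfComplementary k ℓ = ∅ := by
  obtain ⟨a, rfl⟩ := hk
  obtain ⟨b, rfl⟩ := hℓ
  refine Finset.filter_eq_empty_iff.2 fun lam _ h => ?_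
  have hmid := h ⟨a, by omega⟩
  have hrev : (⟨a, by omega⟩ : Fin (2 * a + 1)).rev = ⟨a, by omega⟩ := by
    ext
    simp only [Fin.val_rev]
    omega
  rw [hrev] at hmid
  omega

/-- A self-complementary partition is determined by the excess over `ℓ / 2` of the parts in its
upper half, and this excess can be any partition in the rectangle of half the size. -/
lemma card_selfComplementary {k ℓ : ℕ} (h : ¬(Odd k ∧ Odd ℓ)) :
    (selfComplementary k ℓ).card = (rectPartitions (k / 2) (ℓ / 2)).card := by
  have hpar : k % 2 = 0 ∨ ℓ % 2 = 0 := by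
    rw [Nat.odd_iff, Nat.odd_iff] at h
    omega
  refine Finset.card_bij
    (fun lam _ (i : Fin (k / 2)) => lam ⟨i, by omega⟩ - (ℓ + 1) / 2) ?_ ?_ ?_
  · intro lam hlam
    obtain ⟨hmem, -⟩ := Finset.mem_filter.1 hlam
    obtain ⟨hle, hanti⟩ := mem_rectPartitions.1 hmem
    refine mem_rectPartitions.2 ⟨fun i => ?_, fun i j hij => ?_⟩
    · have := hle ⟨i, by omega⟩
      omega
    · exact Nat.sub_le_sub_right (hanti _ _ hij) _
  · intro lam hlam mu hmu heq
    obtain ⟨hmem, hlam⟩ := Finset.mem_filter.1 hlam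
    obtain ⟨-, hanti⟩ := mem_rectPartitions.1 hmem
    obtain ⟨hmem', hmu⟩ := Finset.mem_filter.1 hmu
    obtain ⟨-, hanti'⟩ := mem_rectPartitions.1 hmem'
    have upper : ∀ i : Fin k, (i : ℕ) < k / 2 → lam i = mu i := by
      intro i hi
      have hrev : i ≤ i.rev := by
        rw [Fin.le_def, Fin.val_rev]
        omega
      have h1 := hanti i i.rev hrev
      have h2 := hanti' i i.rev hrev
      have h3 := hlam i
      have h4 := hmu i
      have h5 : lam i - (ℓ + 1) / 2 = mu i - (ℓ + 1) / 2 := congrFun heq ⟨i, hi⟩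
      omega
    funext i
    have h1 := hlam i
    have h2 := hmu i
    by_cases hi : (i : ℕ) < k / 2
    · exact upper i hi
    by_cases hi' : (i.rev : ℕ) < k / 2
    · have := upper i.rev hi'
      omega
    · have hrev : i.rev = i := by
        ext
        rw [Fin.val_rev] at hi' ⊢
        omega
      rw [hrev] at h1 h2
      omega
  · intro mu hmu
    obtain ⟨hle, hanti⟩ := mem_rectPartitions.1 hmu
    let m : ℕ → ℕ := fun n => if hn : n < k / 2 then mu ⟨n, hn⟩ else 0
    have hm : ∀ n, m n ≤ ℓ / 2 := fun n => by
      dsimp only [m]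
      split_ifs
      exacts [hle _, Nat.zero_le _]
    have hm_out : ∀ n, k / 2 ≤ n → m n = 0 := fun n hn => dif_neg (by omega)
    have hm_anti : ∀ n p, n ≤ p → m p ≤ m n := fun n p hnp => by
      by_cases hp : p < k / 2
      · have hn : n < k / 2 := by omega
        simp only [m, hp, hn, dif_pos]
        exact hanti _ _ hnp
      · simp [hm_out p (by omega)]
    refine ⟨fun i => if (i : ℕ) < k / 2 then m i + (ℓ + 1) / 2 else ℓ / 2 - m (k - 1 - i),
      Finset.mem_filter.2 ⟨mem_rectPartitions.2 ⟨fun i => ?_, fun i j hij => ?_⟩, fun i => ?_⟩, ?_⟩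
    · have := hm i
      split_ifs <;> omega
    · have h1 := hm_anti i j hij
      have h2 := hm_anti (k - 1 - j) (k - 1 - i) (by have := Fin.le_def.1 hij; omega)
      have := Fin.le_def.1 hij
      split_ifs <;> omega
    · have hi := i.isLt
      have hrev : (i.rev : ℕ) = k - 1 - i := by
        rw [Fin.val_rev]
        omega
      have hrev' : k - 1 - (k - 1 - (i : ℕ)) = i := by omega
      have h1 := hm i
      have h2 := hm (k - 1 - i)
      have h3 := hm_out i
      have h4 := hm_out (k - 1 - i)
      simp only [hrev, hrev']
      split_ifs <;> omega
    · funext i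
      simp [m]

/-- (The `q = −1` phenomenon for partitions in a rectangle, Section 4.) The alternating sum
`∑_{λ ∈ P(k,ℓ)} (−1)^{|λ|}` equals the number of self-complementary partitions in the
`k × ℓ` rectangle; this is the evaluation at `q = −1` of the Gaussian binomial coefficient. -/
theorem q_eq_neg_one_partitions_in_rectangle (k ℓ : ℕ) (hk : 0 < k) (hℓ : 0 < ℓ) :
    (∑ lam ∈ Finset.univ.filter
        (fun lam : Fin k → Fin (ℓ + 1) => ∀ i j : Fin k, i ≤ j → lam j ≤ lam i),
      (-1 : ℤ) ^ (∑ i : Fin k, (lam i : ℕ))) =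
      (Nat.card {lam : Fin k → ℕ //
        (∀ i j : Fin k, i ≤ j → lam j ≤ lam i) ∧ (∀ i : Fin k, lam i ≤ ℓ) ∧
        ∀ i : Fin k, lam i + lam i.rev = ℓ} : ℤ) := by
  have hleft : (∑ lam ∈ Finset.univ.filter
        (fun lam : Fin k → Fin (ℓ + 1) => ∀ i j : Fin k, i ≤ j → lam j ≤ lam i),
      (-1 : ℤ) ^ (∑ i : Fin k, (lam i : ℕ))) =
      ∑ lam ∈ rectPartitions k ℓ, (-1 : ℤ) ^ (∑ i, lam i) := by
    refine Finset.sum_bij (fun lam _ i => (lam i : ℕ)) ?_ ?_ ?_ fun _ _ => rfl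
    · intro lam hlam
      exact mem_rectPartitions.2
        ⟨fun i => Nat.le_of_lt_succ (lam i).isLt, (Finset.mem_filter.1 hlam).2⟩
    · exact fun lam _ mu _ h => funext fun i => Fin.ext (congrFun h i)
    · intro mu hmu
      obtain ⟨hle, hanti⟩ := mem_rectPartitions.1 hmu
      exact ⟨fun i => ⟨mu i, Nat.lt_succ_of_le (hle i)⟩,
        Finset.mem_filter.2 ⟨Finset.mem_univ _, hanti⟩, rfl⟩
  have hright : Nat.card {lam : Fin k → ℕ //
        (∀ i j : Fin k, i ≤ j → lam j ≤ lam i) ∧ (∀ i : Fin k, lam i ≤ ℓ) ∧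
        ∀ i : Fin k, lam i + lam i.rev = ℓ} = (selfComplementary k ℓ).card :=
    Nat.subtype_card _ fun lam => by
      rw [selfComplementary, Finset.mem_filter, mem_rectPartitions]
      tauto
  rw [hleft, hright, sum_neg_one_pow_rectPartitions]
  split_ifs with h
  · simp [selfComplementary_eq_empty h.1 h.2]
  · rw [card_selfComplementary h, card_rectPartitions]
end

section
/- Let r, c, t be positive integers. The linear map d on the free 𝔽₂-vector space C(r,c,t) with basis indexed by SSYT(r,c,t) satisfies d ∘ d = 0, i.e. (C(r,c,t), d) is a chain complex. -/
/-- The semistandardness condition for a filling of the `r × c` rectangle with values in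
`{0, …, r+t−1}`: rows weakly increase and columns strictly increase. -/
def SSYTCond (r c t : ℕ) (T : Fin r → Fin c → Fin (r + t)) : Prop :=
  (∀ (i : Fin r) (j j' : Fin c), j ≤ j' → T i j ≤ T i j') ∧
  (∀ (i i' : Fin r) (j : Fin c), i < i' → T i j < T i' j)

instance (r c t : ℕ) : DecidablePred (SSYTCond r c t) := fun _ => by
  unfold SSYTCond; infer_instance

/-- `SSYT(r,c,t)`: semistandard Young tableaux of rectangular shape `r × c` with entries in
`{0, …, r+t−1}`; these index the basis of the chain complex `C(r,c,t)`. -/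
abbrev SSYT (r c t : ℕ) : Type := {T : Fin r → Fin c → Fin (r + t) // SSYTCond r c t T}

/-- "`i = 0` or `T(i−1, j) ≠ v − 1`": the entry directly above position `(i,j)` (if any) is not
`v − 1`. -/
abbrev NoAbove (r c t : ℕ) (T : Fin r → Fin c → Fin (r + t)) (i : Fin r) (j : Fin c)
    (v : ℕ) : Prop :=
  ∀ i' : Fin r, (i' : ℕ) + 1 = (i : ℕ) → (T i' j : ℕ) ≠ v - 1

/-- The number of columns `j` with `T(i,j) = v` and no `v − 1` directly above. -/
def decCount (r c t : ℕ) (T : Fin r → Fin c → Fin (r + t)) (i : Fin r) (v : ℕ) : ℕ :=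
  (Finset.univ.filter fun j : Fin c => (T i j : ℕ) = v ∧ NoAbove r c t T i j v).card

/-- The filling obtained from `T` by replacing the leftmost entry equal to `v` in row `i`
by `v − 1` (and leaving `T` unchanged if `v` does not occur in row `i`). -/
def replLeftmost (r c t : ℕ) (T : Fin r → Fin c → Fin (r + t)) (i : Fin r) (v : Fin (r + t)) :
    Fin r → Fin c → Fin (r + t) := fun i' j' =>
  if i' = i ∧ T i' j' = v ∧ ∀ j'' : Fin c, j'' < j' → T i' j'' ≠ v then
    ⟨(v : ℕ) - 1, Nat.lt_of_le_of_lt (Nat.sub_le _ _) v.2⟩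
  else T i' j'

/-- The boundary map `d` of the complex `C(r,c,t)` over `𝔽₂`: `d(e_T) = ∑ e_{T'}`, summed over
pairs `(i, v)` with `v` odd such that the number of copies of `v` in row `i` without `v − 1`
directly above is odd and the tableau `T'`, obtained by decrementing the leftmost `v` in
row `i`, is again semistandard. -/
noncomputable def dSSYT (r c t : ℕ) :
    (SSYT r c t →₀ ZMod 2) →ₗ[ZMod 2] (SSYT r c t →₀ ZMod 2) :=
  Finsupp.lift _ _ _ fun T : SSYT r c t =>
    ∑ i : Fin r, ∑ v : Fin (r + t),
      if h : Odd (v : ℕ) ∧ Odd (decCount r c t T.1 i (v : ℕ)) ∧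
          SSYTCond r c t (replLeftmost r c t T.1 i v) then
        Finsupp.single (⟨replLeftmost r c t T.1 i v, h.2.2⟩ : SSYT r c t) (1 : ZMod 2)
      else 0

section SSYT

variable {r c t : ℕ}

/-- Position `(i, j)` holds the leftmost entry `v` of row `i`. -/
def IsLeftmost (T : Fin r → Fin c → Fin (r + t)) (i : Fin r) (v : Fin (r + t)) (j : Fin c) :
    Prop :=
  T i j = v ∧ ∀ j' < j, T i j' ≠ v

theorem replLeftmost_of_isLeftmost {T : Fin r → Fin c → Fin (r + t)} {i : Fin r}
    {v : Fin (r + t)} {j : Fin c} (h : IsLeftmost T i v j) :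
    (replLeftmost r c t T i v i j : ℕ) = v - 1 :=
  congrArg Fin.val (if_pos ⟨rfl, h⟩)

theorem replLeftmost_of_not {T : Fin r → Fin c → Fin (r + t)} {i k : Fin r}
    {v : Fin (r + t)} {j : Fin c} (h : ¬ (k = i ∧ IsLeftmost T i v j)) :
    replLeftmost r c t T i v k j = T k j := by
  refine if_neg ?_
  rintro ⟨rfl, hl⟩
  exact h ⟨rfl, hl⟩

/-- Decrementing the leftmost `v` of row `i` preserves semistandardness exactly when the entry
above it is not `v - 1`. -/
theorem ssytCond_replLeftmost_iff {T : Fin r → Fin c → Fin (r + t)} (hT : SSYTCond r c t T)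
    (i : Fin r) {v : Fin (r + t)} (hv : Odd (v : ℕ)) :
    SSYTCond r c t (replLeftmost r c t T i v) ↔
      ∀ j, IsLeftmost T i v j → NoAbove r c t T i j v := by
  have hv0 := hv.pos
  constructor
  · rintro h j hj k hk
    have hlt := h.2 k i j (Fin.lt_def.2 (by omega))
    rw [replLeftmost_of_not (k := k) (fun h' => by have := congrArg Fin.val h'.1; omega),
      Fin.lt_def, replLeftmost_of_isLeftmost hj] at hlt
    exact hlt.ne
  · intro h
    constructor
    · intro k j j' hjj'
      have hle := hT.1 k j j' hjj'
      by_cases h1 : k = i ∧ IsLeftmost T i v j <;> by_cases h2 : k = i ∧ IsLeftmost T i v j'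
      · obtain ⟨rfl, h1⟩ := h1
        rw [Fin.le_def, replLeftmost_of_isLeftmost h1, replLeftmost_of_isLeftmost h2.2]
      · obtain ⟨rfl, h1⟩ := h1
        rw [Fin.le_def, replLeftmost_of_isLeftmost h1, replLeftmost_of_not h2]
        rw [h1.1, Fin.le_def] at hle
        omega
      · obtain ⟨rfl, h2⟩ := h2
        rw [Fin.le_def, replLeftmost_of_isLeftmost h2, replLeftmost_of_not h1]
        have hne : T k j ≠ v := by
          rcases hjj'.lt_or_eq with hlt | rfl
          · exact h2.2 j hlt
          · exact absurd ⟨rfl, h2⟩ h1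
        rw [h2.1, Fin.le_def] at hle
        have := Fin.val_ne_of_ne hne
        omega
      · rwa [replLeftmost_of_not h1, replLeftmost_of_not h2]
    · intro k k' j hkk'
      have hlt := hT.2 k k' j hkk'
      by_cases h1 : k = i ∧ IsLeftmost T i v j <;> by_cases h2 : k' = i ∧ IsLeftmost T i v j
      · exact absurd (h1.1.trans h2.1.symm) hkk'.ne
      · obtain ⟨rfl, h1⟩ := h1
        rw [Fin.lt_def, replLeftmost_of_isLeftmost h1, replLeftmost_of_not h2]
        rw [h1.1, Fin.lt_def] at hlt
        omega
      · obtain ⟨rfl, h2⟩ := h2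
        rw [Fin.lt_def, replLeftmost_of_isLeftmost h2, replLeftmost_of_not h1]
        rw [Fin.lt_def] at hkk'
        let m : Fin r := ⟨k' - 1, by omega⟩
        have hm : (m : ℕ) + 1 = k' := Nat.sub_add_cancel (by omega)
        have hne := h j h2 m hm
        have hmlt := hT.2 m k' j (Fin.lt_def.2 (by omega))
        rw [h2.1, Fin.lt_def] at hmlt
        have hkm : T k j ≤ T m j := by
          rcases (show k ≤ m from Fin.le_def.2 (by omega)).lt_or_eq with hlt' | heq
          · exact (hT.2 k m j hlt').le
          · rw [heq]
        rw [Fin.le_def] at hkm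
        omega
      · rwa [replLeftmost_of_not h1, replLeftmost_of_not h2]

theorem replLeftmost_eq_iff {T : Fin r → Fin c → Fin (r + t)} {i k : Fin r}
    {v w : Fin (r + t)} (hv : Odd (v : ℕ)) (hw : Odd (w : ℕ)) (hne : (i, v) ≠ (k, w))
    (j : Fin c) : replLeftmost r c t T i v k j = w ↔ T k j = w := by
  by_cases h : k = i ∧ IsLeftmost T i v j
  · obtain ⟨rfl, h⟩ := h
    rw [Fin.ext_iff, replLeftmost_of_isLeftmost h, h.1]
    refine iff_of_false ?_ (fun h' => hne (by rw [h']))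
    obtain ⟨a, ha⟩ := hv
    obtain ⟨b, hb⟩ := hw
    omega
  · rw [replLeftmost_of_not h]

theorem isLeftmost_replLeftmost_iff {T : Fin r → Fin c → Fin (r + t)} {i k : Fin r}
    {v w : Fin (r + t)} (hv : Odd (v : ℕ)) (hw : Odd (w : ℕ)) (hne : (i, v) ≠ (k, w))
    (j : Fin c) : IsLeftmost (replLeftmost r c t T i v) k w j ↔ IsLeftmost T k w j := by
  simp only [IsLeftmost, ne_eq, replLeftmost_eq_iff hv hw hne]

theorem noAbove_replLeftmost_iff {T : Fin r → Fin c → Fin (r + t)} (hT : SSYTCond r c t T)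
    {i k : Fin r} {v w : Fin (r + t)} (hv : Odd (v : ℕ)) (hw : Odd (w : ℕ))
    {j : Fin c} (hj : T k j = w) :
    NoAbove r c t (replLeftmost r c t T i v) k j w ↔ NoAbove r c t T k j w := by
  refine forall₂_congr fun m hm => not_congr ?_
  by_cases h : m = i ∧ IsLeftmost T i v j
  · obtain ⟨rfl, h⟩ := h
    have hlt := hT.2 m k j (Fin.lt_def.2 (by omega))
    rw [h.1, hj, Fin.lt_def] at hlt
    rw [replLeftmost_of_isLeftmost h, h.1]
    obtain ⟨a, ha⟩ := hv
    obtain ⟨b, hb⟩ := hw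
    omega
  · rw [replLeftmost_of_not h]

/-- The condition for `(i, v)` to contribute to the boundary of `T`. -/
def Contributes (T : Fin r → Fin c → Fin (r + t)) (p : Fin r × Fin (r + t)) : Prop :=
  Odd (p.2 : ℕ) ∧ Odd (decCount r c t T p.1 (p.2 : ℕ)) ∧
    SSYTCond r c t (replLeftmost r c t T p.1 p.2)

theorem Contributes.replLeftmost_iff {T : Fin r → Fin c → Fin (r + t)} (hT : SSYTCond r c t T)
    {p q : Fin r × Fin (r + t)} (hp : Contributes T p) (hne : p ≠ q) :
    Contributes (replLeftmost r c t T p.1 p.2) q ↔ Contributes T q := by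
  refine and_congr_right fun hw => and_congr ?_ ?_
  · have hcount : decCount r c t (replLeftmost r c t T p.1 p.2) q.1 q.2 =
        decCount r c t T q.1 q.2 := by
      refine congrArg Finset.card (Finset.filter_congr fun j _ => ?_)
      rw [← Fin.ext_iff, ← Fin.ext_iff, replLeftmost_eq_iff hp.1 hw hne]
      exact and_congr_right fun hj => noAbove_replLeftmost_iff hT hp.1 hw hj
    rw [hcount]
  · rw [ssytCond_replLeftmost_iff hp.2.2 _ hw, ssytCond_replLeftmost_iff hT _ hw]
    refine forall_congr' fun j => ?_
    rw [isLeftmost_replLeftmost_iff hp.1 hw hne]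
    exact forall_congr' fun hj => noAbove_replLeftmost_iff hT hp.1 hw hj.1

theorem replLeftmost_comm (T : Fin r → Fin c → Fin (r + t)) {p q : Fin r × Fin (r + t)}
    (hp : Odd (p.2 : ℕ)) (hq : Odd (q.2 : ℕ)) :
    replLeftmost r c t (replLeftmost r c t T p.1 p.2) q.1 q.2 =
      replLeftmost r c t (replLeftmost r c t T q.1 q.2) p.1 p.2 := by
  rcases eq_or_ne p q with rfl | hne
  · rfl
  funext k j
  have hl := isLeftmost_replLeftmost_iff (T := T) hp hq hne j
  have hl' := isLeftmost_replLeftmost_iff (T := T) hq hp hne.symm j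
  by_cases h1 : k = p.1 ∧ IsLeftmost T p.1 p.2 j <;>
    by_cases h2 : k = q.1 ∧ IsLeftmost T q.1 q.2 j
  · exact absurd (Prod.ext (h1.1.symm.trans h2.1)
      (h1.2.1.symm.trans (by rw [← h1.1, h2.1, h2.2.1]))) hne
  · rw [replLeftmost_of_not (by rwa [hl])]
    obtain ⟨rfl, h1⟩ := h1
    ext
    rw [replLeftmost_of_isLeftmost h1, replLeftmost_of_isLeftmost (hl'.2 h1)]
  · rw [replLeftmost_of_not (i := p.1) (by rwa [hl'])]
    obtain ⟨rfl, h2⟩ := h2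
    ext
    rw [replLeftmost_of_isLeftmost h2, replLeftmost_of_isLeftmost (hl.2 h2)]
  · rw [replLeftmost_of_not (by rwa [hl]), replLeftmost_of_not h1,
      replLeftmost_of_not (by rwa [hl']), replLeftmost_of_not h2]

/-- An admissible decrement lowers its own count by one. -/
theorem Contributes.not_replLeftmost_self {T : Fin r → Fin c → Fin (r + t)}
    (hT : SSYTCond r c t T) {p : Fin r × Fin (r + t)} (hp : Contributes T p) :
    ¬ Contributes (replLeftmost r c t T p.1 p.2) p := by
  classical
  obtain ⟨i, v⟩ := p
  obtain ⟨hv, hodd, hS⟩ := hp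
  rw [ssytCond_replLeftmost_iff hT _ hv] at hS
  dsimp only at hv hodd hS ⊢
  rintro ⟨-, hoddRepl, -⟩
  dsimp only at hoddRepl
  obtain ⟨j, hj⟩ : ∃ j, IsLeftmost T i v j := by
    obtain ⟨j, hj⟩ := Finset.card_pos.1 hodd.pos
    have hmem : ∃ j, T i j = v := ⟨j, Fin.ext (Finset.mem_filter.1 hj).2.1⟩
    exact ⟨Fin.find _ hmem, Fin.find_spec hmem, fun j' hj' => Fin.find_min hmem hj'⟩
  have hcount : decCount r c t (replLeftmost r c t T i v) i v + 1 = decCount r c t T i v := by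
    unfold decCount
    rw [← Finset.card_erase_add_one (s := Finset.univ.filter fun j : Fin c =>
      (T i j : ℕ) = v ∧ NoAbove r c t T i j v) (a := j)
      (Finset.mem_filter.2 ⟨Finset.mem_univ _, congrArg Fin.val hj.1, hS j hj⟩)]
    congr 2
    ext j'
    simp only [Finset.mem_filter, Finset.mem_univ, true_and, Finset.mem_erase]
    by_cases h : j' = j
    · subst h
      rw [replLeftmost_of_isLeftmost hj]
      have := hv.pos
      exact iff_of_false (fun h => by omega) (fun h => h.1 rfl)
    · have hj' : ¬ (i = i ∧ IsLeftmost T i v j') := by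
        rintro ⟨-, h'⟩
        rcases lt_or_gt_of_ne h with hlt | hlt
        · exact hj.2 _ hlt h'.1
        · exact h'.2 _ hlt hj.1
      rw [replLeftmost_of_not hj']
      simp only [ne_eq, h, not_false_eq_true, true_and]
      exact and_congr_right fun h' => noAbove_replLeftmost_iff hT hv hv (Fin.ext h')
  rw [← hcount, Nat.odd_add_one] at hodd
  exact hodd hoddRepl

open Classical in
/-- The summand of the boundary map indexed by `p = (i, v)`. -/
noncomputable def dTerm (p : Fin r × Fin (r + t)) :
    (SSYT r c t →₀ ZMod 2) →ₗ[ZMod 2] (SSYT r c t →₀ ZMod 2) :=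
  Finsupp.lift _ _ _ fun T : SSYT r c t =>
    if h : Contributes T.1 p then
      Finsupp.single (⟨replLeftmost r c t T.1 p.1 p.2, h.2.2⟩ : SSYT r c t) (1 : ZMod 2)
    else 0

theorem dTerm_single_of_contributes {p : Fin r × Fin (r + t)} {T : SSYT r c t}
    (h : Contributes T.1 p) :
    dTerm p (Finsupp.single T 1) = Finsupp.single ⟨replLeftmost r c t T.1 p.1 p.2, h.2.2⟩ 1 := by
  simp [dTerm, h]

theorem dTerm_single_of_not_contributes {p : Fin r × Fin (r + t)} {T : SSYT r c t}
    (h : ¬ Contributes T.1 p) : dTerm p (Finsupp.single T 1) = 0 := by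
  simp [dTerm, h]

theorem dSSYT_eq_sum_dTerm : dSSYT r c t = ∑ p : Fin r × Fin (r + t), dTerm p := by
  refine Finsupp.lhom_ext' fun T => LinearMap.ext_ring ?_
  simp only [dSSYT, LinearMap.comp_apply, LinearMap.sum_apply,
    Finsupp.lsingle_apply, Finsupp.lift_apply, Fintype.sum_prod_type, zero_smul,
    Finsupp.sum_single_index, one_smul]
  refine Finset.sum_congr rfl fun i _ => Finset.sum_congr rfl fun v _ => ?_
  by_cases h : Contributes T.1 (i, v)
  · exact (dif_pos h).trans (dTerm_single_of_contributes h).symm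
  · exact (dif_neg h).trans (dTerm_single_of_not_contributes h).symm

theorem dTerm_comp_self (p : Fin r × Fin (r + t)) :
    (dTerm p).comp (dTerm (c := c) p) = 0 := by
  refine Finsupp.lhom_ext' fun T => LinearMap.ext_ring ?_
  simp only [LinearMap.comp_apply, Finsupp.lsingle_apply, LinearMap.zero_apply]
  by_cases h : Contributes T.1 p
  · rw [dTerm_single_of_contributes h,
      dTerm_single_of_not_contributes (h.not_replLeftmost_self T.2)]
  · rw [dTerm_single_of_not_contributes h, map_zero]

theorem dTerm_comm (p q : Fin r × Fin (r + t)) :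
    (dTerm p).comp (dTerm (c := c) q) = (dTerm q).comp (dTerm p) := by
  rcases eq_or_ne p q with rfl | hne
  · rfl
  refine Finsupp.lhom_ext' fun T => LinearMap.ext_ring ?_
  simp only [LinearMap.comp_apply, Finsupp.lsingle_apply]
  by_cases hp : Contributes T.1 p <;> by_cases hq : Contributes T.1 q
  · rw [dTerm_single_of_contributes hp, dTerm_single_of_contributes hq,
      dTerm_single_of_contributes ((hq.replLeftmost_iff T.2 hne.symm).2 hp),
      dTerm_single_of_contributes ((hp.replLeftmost_iff T.2 hne).2 hq)]
    congr 2
    exact replLeftmost_comm T.1 hq.1 hp.1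
  · rw [dTerm_single_of_contributes hp, dTerm_single_of_not_contributes hq, map_zero,
      dTerm_single_of_not_contributes (mt (hp.replLeftmost_iff T.2 hne).1 hq)]
  · rw [dTerm_single_of_not_contributes hp, dTerm_single_of_contributes hq, map_zero,
      dTerm_single_of_not_contributes (mt (hq.replLeftmost_iff T.2 hne.symm).1 hp)]
  · rw [dTerm_single_of_not_contributes hp, dTerm_single_of_not_contributes hq, map_zero,
      map_zero]

end SSYT

/-- (Proposition 5.1.) `(C(r,c,t), d)` is a chain complex: `d ∘ d = 0`. -/
theorem dSSYT_squared_eq_zero (r c t : ℕ) (hr : 0 < r) (hc : 0 < c) (ht : 0 < t) :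
    (dSSYT r c t).comp (dSSYT r c t) = 0 := by
  rw [dSSYT_eq_sum_dTerm, ← Module.End.mul_eq_comp, Finset.sum_mul_sum,
    ← Finset.sum_product']
  refine Finset.sum_involution (fun x _ => x.swap) (fun x _ => ?_) (fun x _ hx h => ?_)
    (fun _ _ => Finset.mem_univ _) (fun x _ => x.swap_swap)
  · rw [Prod.fst_swap, Prod.snd_swap, Module.End.mul_eq_comp, Module.End.mul_eq_comp,
      dTerm_comm x.2 x.1, ← two_smul (ZMod 2), show (2 : ZMod 2) = 0 from rfl, zero_smul]
  · have h' : x.2 = x.1 := congrArg Prod.fst h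
    rw [h', Module.End.mul_eq_comp, dTerm_comp_self] at hx
    exact hx rfl
end

section
/- Let r, c, t be positive integers and let T ∈ SSYT(r,c,t) satisfy: (a) for every position (i,j) with T(i,j) even and T(i,j) < r+t−1, one has i+1 < r and T(i+1,j) = T(i,j)+1; and (b) for every row i and every odd value v, the number of columns j with T(i,j) = v and (i = 0 or T(i−1,j) ≠ v−1) is even. Then the sum of all entries of T is congruent to c·(r choose 2) modulo 2. -/
open scoped Classical in
/-- If every `decCount` at an odd value is even, then row `i` has an even number of odd entries
which do not continue the entry directly above. -/
theorem even_card_odd_noAbove {r c t : ℕ} (T : Fin r → Fin c → Fin (r + t)) (i : Fin r)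
    (hb : ∀ v : ℕ, Odd v → Even (decCount r c t T i v)) :
    Even (Finset.univ.filter fun j : Fin c =>
      Odd (T i j : ℕ) ∧ NoAbove r c t T i j (T i j)).card := by
  rw [Finset.card_eq_sum_card_fiberwise (f := fun j => (T i j : ℕ))
    (t := (Finset.range (r + t)).filter Odd)]
  · refine Finset.even_sum _ fun v hv => ?_
    have hodd := (Finset.mem_filter.mp hv).2
    refine Eq.mp (congrArg Even (congrArg Finset.card ?_)) (hb v hodd)
    ext j
    simp only [Finset.mem_filter, Finset.mem_univ, true_and]
    constructor
    · rintro ⟨rfl, h⟩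
      exact ⟨⟨hodd, h⟩, rfl⟩
    · rintro ⟨⟨-, h⟩, rfl⟩
      exact ⟨rfl, h⟩
  · intro j hj
    simp only [Finset.coe_filter, Finset.mem_univ, true_and, Set.mem_ofPred_eq] at hj
    simp [hj.1]

/-- Under the two criticality conditions, row `i` has entry sum congruent to `i * c` modulo `2`. -/
theorem row_sum_mod_two {r c t : ℕ} (T : SSYT r c t)
    (ha : ∀ (i : Fin r) (j : Fin c), Even (T.1 i j : ℕ) → (T.1 i j : ℕ) < r + t - 1 →
      ∃ i' : Fin r, (i' : ℕ) = (i : ℕ) + 1 ∧ (T.1 i' j : ℕ) = (T.1 i j : ℕ) + 1)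
    (hb : ∀ (i : Fin r) (v : ℕ), Odd v → Even (decCount r c t T.1 i v)) (i : ℕ) (hi : i < r) :
    ∑ j : Fin c, ((T.1 ⟨i, hi⟩ j : ℕ) : ZMod 2) = (i : ZMod 2) * c := by
  classical
  have hfree : ∑ j : Fin c, (if Odd (T.1 ⟨i, hi⟩ j : ℕ) ∧
      NoAbove r c t T.1 ⟨i, hi⟩ j (T.1 ⟨i, hi⟩ j) then (1 : ZMod 2) else 0) = 0 := by
    rw [Finset.sum_boole, ZMod.natCast_eq_zero_iff_even]
    exact even_card_odd_noAbove T.1 ⟨i, hi⟩ (hb _)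
  induction i with
  | zero =>
    rw [Nat.cast_zero, zero_mul, ← hfree]
    refine Finset.sum_congr rfl fun j _ => ?_
    have hna : NoAbove r c t T.1 ⟨0, hi⟩ j (T.1 ⟨0, hi⟩ j) := fun i' h => by simp at h
    split_ifs with h
    · exact ZMod.natCast_eq_one_iff_odd.mpr h.1
    · exact ZMod.natCast_eq_zero_iff_even.mpr (Nat.not_odd_iff_even.mp fun ho => h ⟨ho, hna⟩)
  | succ k ih =>
    have hk : k < r := by omega
    have hrow : ∑ j : Fin c, ((T.1 ⟨k, hk⟩ j : ℕ) : ZMod 2) = (k : ZMod 2) * c := by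
      refine ih hk ?_
      rw [Finset.sum_boole, ZMod.natCast_eq_zero_iff_even]
      exact even_card_odd_noAbove T.1 ⟨k, hk⟩ (hb _)
    have hstep : ∀ j : Fin c, ((T.1 ⟨k + 1, hi⟩ j : ℕ) : ZMod 2) =
        (1 + ((T.1 ⟨k, hk⟩ j : ℕ) : ZMod 2)) + (if Odd (T.1 ⟨k + 1, hi⟩ j : ℕ) ∧
          NoAbove r c t T.1 ⟨k + 1, hi⟩ j (T.1 ⟨k + 1, hi⟩ j) then (1 : ZMod 2) else 0) := by
      intro j
      have hlt : (T.1 ⟨k, hk⟩ j : ℕ) < T.1 ⟨k + 1, hi⟩ j :=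
        T.2.2 ⟨k, hk⟩ ⟨k + 1, hi⟩ j (by simp)
      have hbound := (T.1 ⟨k + 1, hi⟩ j).2
      rcases Nat.even_or_odd (T.1 ⟨k, hk⟩ j : ℕ) with he | ho
      · obtain ⟨i', hi', hT⟩ := ha ⟨k, hk⟩ j he (by omega)
        obtain rfl : i' = ⟨k + 1, hi⟩ := Fin.ext hi'
        have hna : ¬ NoAbove r c t T.1 ⟨k + 1, hi⟩ j (T.1 ⟨k + 1, hi⟩ j) :=
          fun h => h ⟨k, hk⟩ rfl (by omega)
        rw [if_neg fun h => hna h.2, hT]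
        push_cast
        ring
      · rw [ZMod.natCast_eq_one_iff_odd.mpr ho, CharTwo.add_self_eq_zero, zero_add]
        split_ifs with h
        · exact ZMod.natCast_eq_one_iff_odd.mpr h.1
        · refine ZMod.natCast_eq_zero_iff_even.mpr (Nat.not_odd_iff_even.mp fun ho' => h ⟨ho', ?_⟩)
          intro i' hi' heq
          obtain rfl : i' = ⟨k, hk⟩ := Fin.ext (by simpa using hi')
          rw [Nat.odd_iff] at ho ho'
          omega
    rw [Finset.sum_congr rfl fun j _ => hstep j, Finset.sum_add_distrib, hfree,
      Finset.sum_add_distrib, hrow]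
    simp only [Finset.sum_const, Finset.card_univ, Fintype.card_fin, nsmul_eq_mul, mul_one,
      add_zero, Nat.cast_add, Nat.cast_one]
    ring

/-- (Corollary 5.4.) Any critical cell `T` of the Morse matching on `SSYT(r,c,t)` — i.e. any
`T` such that (a) every even entry `v < r+t−1` at position `(i,j)` has `v + 1` directly below
it, and (b) for every row `i` and odd value `v`, the number of copies of `v` in row `i` with no
`v − 1` directly above is even — has even rank: the sum of the entries of `T` is congruent to
`c · C(r,2)` modulo `2`. -/
theorem critical_cell_rank_even (r c t : ℕ) (hr : 0 < r) (hc : 0 < c) (ht : 0 < t)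
    (T : SSYT r c t)
    (ha : ∀ (i : Fin r) (j : Fin c), Even (T.1 i j : ℕ) → (T.1 i j : ℕ) < r + t - 1 →
      ∃ i' : Fin r, (i' : ℕ) = (i : ℕ) + 1 ∧ (T.1 i' j : ℕ) = (T.1 i j : ℕ) + 1)
    (hb : ∀ (i : Fin r) (v : ℕ), Odd v → Even (decCount r c t T.1 i v)) :
    (∑ i : Fin r, ∑ j : Fin c, (T.1 i j : ℕ)) % 2 = (c * Nat.choose r 2) % 2 := by
  change _ ≡ _ [MOD 2]
  rw [← ZMod.natCast_eq_natCast_iff]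
  push_cast
  have hrow : ∀ i : Fin r, ∑ j : Fin c, ((T.1 i j : ℕ) : ZMod 2) = ((i : ℕ) : ZMod 2) * c :=
    fun i => row_sum_mod_two T ha hb i i.2
  rw [Finset.sum_congr rfl fun i _ => hrow i, ← Finset.sum_mul,
    Fin.sum_univ_eq_sum_range (fun i => (i : ZMod 2)) r, ← Nat.cast_sum,
    Finset.sum_range_id, Nat.choose_two_right, mul_comm]
end
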